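/- Let d, n ≥ 1, 1 < q < p < ∞, and let W be a matrix A_q weight on ℝ^d. Then the weighted maximal operator M_{W,p} is bounded from L^p(ℝ^d; ℂⁿ) to L^p(ℝ^d): there is a constant c depending only on n, d, p, q such that ‖M_{W,p} f‖_{L^p(ℝ^d)} ≤ c · [W]_{A_q}^{1/p} · ‖f‖_{L^p(ℝ^d;ℂⁿ)} for every f ∈ L^p(ℝ^d; ℂⁿ). -/

import Mathlib

open MeasureTheory ENNReal
open scoped ComplexOrder

noncomputable section

abbrev Rd (d : ℕ) := EuclideanSpace ℝ (Fin d)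
abbrev Mat (n : ℕ) := Matrix (Fin n) (Fin n) ℂ
abbrev Vec (n : ℕ) := EuclideanSpace ℂ (Fin n)

/-- A cube in `ℝ^d` with sides parallel to the coordinate axes, given by its
lower-left corner and (positive) side length. -/
structure Cube (d : ℕ) where
  corner : Rd d
  side : ℝ
  side_pos : 0 < side

namespace Cube

/-- The underlying set of the cube. -/
def set {d : ℕ} (Q : Cube d) : Set (Rd d) :=
  {x | ∀ i, Q.corner i ≤ x i ∧ x i ≤ Q.corner i + Q.side}

/-- The concentric triple `3Q` of a cube. -/
def triple {d : ℕ} (Q : Cube d) : Set (Rd d) :=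
  {x | ∀ i, Q.corner i - Q.side ≤ x i ∧ x i ≤ Q.corner i + 2 * Q.side}

end Cube

/-- Operator norm of an `n × n` complex matrix acting on `ℂⁿ` with the Euclidean norm. -/
def opNorm {n : ℕ} (A : Mat n) : ℝ := ‖Matrix.toEuclideanCLM (𝕜 := ℂ) (n := Fin n) A‖

/-- A matrix acting on a Euclidean vector. -/
def mvec {n : ℕ} (A : Mat n) (v : Vec n) : Vec n := Matrix.toEuclideanLin A v

/-- Fractional power of a Hermitian matrix via the spectral calculus (junk value `1`
for non-Hermitian matrices). -/
def matPow {n : ℕ} (A : Mat n) (s : ℝ) : Mat n :=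
  if h : A.IsHermitian then
    (h.eigenvectorUnitary : Mat n) *
      Matrix.diagonal (fun i => ((h.eigenvalues i ^ s : ℝ) : ℂ)) *
      star (h.eigenvectorUnitary : Mat n)
  else 1

/-- A matrix weight: measurable, positive definite (hence Hermitian) a.e. -/
def IsMatrixWeight {d n : ℕ} (W : Rd d → Mat n) : Prop :=
  (∀ i j, Measurable fun x => W x i j) ∧ ∀ᵐ x : Rd d, (W x).PosDef


/-- Componentwise measurability of a `ℂⁿ`-valued function. -/
def MeasurableV {d n : ℕ} (f : Rd d → Vec n) : Prop := ∀ i, Measurable fun x => f x i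
/-- The matrix `A₁` characteristic of `W`. -/
def A1Const {d n : ℕ} (W : Rd d → Mat n) : ℝ≥0∞ :=
  ⨆ Q : Cube d,
    essSup (fun y => (volume Q.set)⁻¹ *
      ∫⁻ x in Q.set, ENNReal.ofReal (opNorm (W x * (W y)⁻¹))) (volume.restrict Q.set)

/-- The matrix `A_q` characteristic of `W`, `1 < q < ∞`. -/
def AqConst {d n : ℕ} (W : Rd d → Mat n) (q : ℝ) : ℝ≥0∞ :=
  ⨆ Q : Cube d, (volume Q.set)⁻¹ * ∫⁻ x in Q.set,
    ((volume Q.set)⁻¹ * ∫⁻ y in Q.set,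
        ENNReal.ofReal (opNorm (matPow (W x) (1/q) * matPow (W y) (-(1/q)))) ^ (q/(q-1))) ^ (q-1)

/-- Hardy–Littlewood maximal operator (over cubes) of an `ℝ≥0∞`-valued function. -/
def HLM {d : ℕ} (g : Rd d → ℝ≥0∞) (x : Rd d) : ℝ≥0∞ :=
  ⨆ (Q : Cube d) (_ : x ∈ Q.set), (volume Q.set)⁻¹ * ∫⁻ y in Q.set, g y

/-- The Fujii–Wilson `A∞` characteristic of a scalar weight `w`. -/
def AInftyConst {d : ℕ} (w : Rd d → ℝ≥0∞) : ℝ≥0∞ :=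
  ⨆ Q : Cube d, (∫⁻ x in Q.set, w x)⁻¹ * ∫⁻ x in Q.set, HLM (Q.set.indicator w) x

/-- The scalar `A_{q,∞}` characteristic of a matrix weight `W`. -/
def AqScConst {d n : ℕ} (W : Rd d → Mat n) (q : ℝ) : ℝ≥0∞ :=
  ⨆ e : Vec n, AInftyConst (fun x => (‖mvec (matPow (W x) (1/q)) e‖₊ : ℝ≥0∞) ^ q)

/-- `L^p` norm of an `ℝ≥0∞`-valued function. -/
def lpNormE {d : ℕ} (p : ℝ) (g : Rd d → ℝ≥0∞) : ℝ≥0∞ := (∫⁻ x, g x ^ p) ^ (1/p)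

/-- `L^p` norm of a `ℂⁿ`-valued function. -/
def lpNormV {d n : ℕ} (p : ℝ) (f : Rd d → Vec n) : ℝ≥0∞ :=
  (∫⁻ x, (‖f x‖₊ : ℝ≥0∞) ^ p) ^ (1/p)

/-- The weighted norm `‖f‖_{L^p(W)}`. -/
def lpWNorm {d n : ℕ} (p : ℝ) (W : Rd d → Mat n) (f : Rd d → Vec n) : ℝ≥0∞ :=
  (∫⁻ x, (‖mvec (matPow (W x) (1/p)) (f x)‖₊ : ℝ≥0∞) ^ p) ^ (1/p)

/-- The weighted maximal operator `M_{W,p}`. -/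
def MWp {d n : ℕ} (W : Rd d → Mat n) (p : ℝ) (f : Rd d → Vec n) (x : Rd d) : ℝ≥0∞ :=
  ⨆ (Q : Cube d) (_ : x ∈ Q.set),
    (volume Q.set)⁻¹ *
      ∫⁻ y in Q.set, (‖mvec (matPow (W x) (1/p) * matPow (W y) (-(1/p))) (f y)‖₊ : ℝ≥0∞)

open scoped NNReal

lemma smul_rpow_of_pos {𝒜 : Type*} [CStarAlgebra 𝒜] [PartialOrder 𝒜] [StarOrderedRing 𝒜]
    {a : 𝒜} (ha : 0 ≤ a) (r : ℝ≥0) {s : ℝ} (hs : 0 < s) : (r • a) ^ s = r ^ s • a ^ s := by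
  have hc : ∀ t : Set ℝ≥0, ContinuousOn (fun x : ℝ≥0 => x ^ s) t := fun t =>
    (NNReal.continuous_rpow_const hs.le).continuousOn
  rw [CFC.rpow_def, CFC.rpow_def, ← cfc_comp_smul r (fun x : ℝ≥0 => x ^ s) a (hc _) ha,
    ← cfc_smul _ _ _ (hc _)]
  simp only [smul_eq_mul, NNReal.mul_rpow]

lemma norm_rpow_mul_rpow_le {𝒜 : Type*} [CStarAlgebra 𝒜] [PartialOrder 𝒜] [StarOrderedRing 𝒜]
    {a b : 𝒜} (ha : IsStrictlyPositive a) (hb : IsStrictlyPositive b) {s : ℝ}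
    (hs0 : 0 < s) (hs1 : s ≤ 1) : ‖a ^ s * b ^ s‖ ≤ ‖a * b‖ ^ s := by
  have hsa : IsSelfAdjoint a := ha.nonneg.isSelfAdjoint
  have hsb : IsSelfAdjoint b := hb.nonneg.isSelfAdjoint
  have sa : IsSelfAdjoint (a ^ s) := (CFC.rpow_nonneg (a := a)).isSelfAdjoint
  have sb : ∀ u : ℝ, IsSelfAdjoint (b ^ u) := fun u => (CFC.rpow_nonneg (a := b)).isSelfAdjoint
  set t : ℝ≥0 := ‖a * b‖₊ ^ 2 with ht
  have h1 : b * (a * a) * b ≤ t • 1 := by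
    have := CStarAlgebra.star_mul_le_algebraMap_norm_sq (a := a * b)
    rw [star_mul, hsa.star_eq, hsb.star_eq, Algebra.algebraMap_eq_smul_one] at this
    calc b * (a * a) * b = b * a * (a * b) := by simp only [mul_assoc]
      _ ≤ _ := this
  have e1 : b ^ (-1 : ℝ) * b = 1 := by
    simpa [CFC.rpow_one b] using CFC.rpow_neg_mul_rpow (a := b) 1
  have e2 : b * b ^ (-1 : ℝ) = 1 := by
    simpa [CFC.rpow_one b] using CFC.rpow_mul_rpow_neg (a := b) 1
  have h2 : a ^ (2 : ℝ) ≤ t • b ^ (-2 : ℝ) := by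
    have := (sb (-1)).conjugate_le_conjugate h1
    have ea : a ^ (2 : ℝ) = a * a := by
      rw [show (2 : ℝ) = 1 + 1 by norm_num, CFC.rpow_add ha.isUnit, CFC.rpow_one a]
    have eb : b ^ (-2 : ℝ) = b ^ (-1 : ℝ) * b ^ (-1 : ℝ) := by
      rw [show (-2 : ℝ) = -1 + -1 by norm_num, CFC.rpow_add hb.isUnit]
    calc a ^ (2 : ℝ) = (b ^ (-1 : ℝ) * b) * (a * a) * (b * b ^ (-1 : ℝ)) := by
          rw [e1, e2, ea]; simp
      _ = b ^ (-1 : ℝ) * (b * (a * a) * b) * b ^ (-1 : ℝ) := by simp only [mul_assoc]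
      _ ≤ b ^ (-1 : ℝ) * (t • 1) * b ^ (-1 : ℝ) := this
      _ = t • b ^ (-2 : ℝ) := by rw [eb]; simp
  have h3 : a ^ (2 * s) ≤ t ^ s • b ^ (-2 * s) := by
    have := CFC.rpow_le_rpow ⟨hs0.le, hs1⟩ h2
    rwa [smul_rpow_of_pos CFC.rpow_nonneg _ hs0, CFC.rpow_rpow a _ _ (by norm_num) ha,
      CFC.rpow_rpow b _ _ (by norm_num) hb] at this
  have h4 : star (a ^ s * b ^ s) * (a ^ s * b ^ s) ≤ algebraMap ℝ 𝒜 ((‖a * b‖ ^ s) ^ 2) := by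
    have := (sb s).conjugate_le_conjugate h3
    calc star (a ^ s * b ^ s) * (a ^ s * b ^ s) = b ^ s * (a ^ s * a ^ s) * b ^ s := by
          rw [star_mul, sa.star_eq, (sb s).star_eq]; simp only [mul_assoc]
      _ = b ^ s * a ^ (2 * s) * b ^ s := by rw [two_mul, CFC.rpow_add ha.isUnit]
      _ ≤ b ^ s * (t ^ s • b ^ (-2 * s)) * b ^ s := this
      _ = t ^ s • b ^ (s + -2 * s + s) := by
          rw [CFC.rpow_add hb.isUnit, CFC.rpow_add hb.isUnit]; simp
      _ = algebraMap ℝ 𝒜 ((‖a * b‖ ^ s) ^ 2) := by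
          rw [show s + -2 * s + s = 0 by ring, CFC.rpow_zero b, Algebra.algebraMap_eq_smul_one]
          have : ((‖a * b‖ ^ s) ^ 2 : ℝ) = ((t ^ s : ℝ≥0) : ℝ) := by
            rw [ht]; push_cast
            rw [← Real.rpow_natCast, ← Real.rpow_natCast, ← Real.rpow_mul (norm_nonneg _),
              ← Real.rpow_mul (norm_nonneg _), mul_comm]
          rw [this]; rfl
  have h5 := (CStarAlgebra.norm_le_iff_le_algebraMap _ (by positivity)
    (star_mul_self_nonneg _)).2 h4
  rw [CStarRing.norm_star_mul_self, ← sq] at h5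
  exact (sq_le_sq₀ (norm_nonneg _) (by positivity)).1 h5

section MatrixPowers

open scoped MatrixOrder Matrix.Norms.L2Operator

lemma matPow_eq_cfc {n : ℕ} {A : Mat n} (hA : A.IsHermitian) (s : ℝ) :
    matPow A s = cfc (fun x : ℝ => x ^ s) A := by
  rw [hA.cfc_eq, matPow, dif_pos hA, Matrix.IsHermitian.cfc, Unitary.conjStarAlgAut_apply]
  rfl

lemma matPow_eq_rpow {n : ℕ} {A : Mat n} (hA : A.PosDef) (s : ℝ) : matPow A s = A ^ s := by
  rw [matPow_eq_cfc hA.1, CFC.rpow_eq_cfc_real (Matrix.nonneg_iff_posSemidef.2 hA.posSemidef)]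

lemma isHermitian_matPow {n : ℕ} {A : Mat n} (hA : A.PosDef) (s : ℝ) :
    (matPow A s).IsHermitian := by
  rw [matPow_eq_rpow hA]
  exact (CFC.rpow_nonneg (a := A)).isSelfAdjoint

lemma matPow_mul_matPow_neg {n : ℕ} {A : Mat n} (hA : A.PosDef) (s : ℝ) :
    matPow A s * matPow A (-s) = 1 := by
  rw [matPow_eq_rpow hA, matPow_eq_rpow hA]
  exact CFC.rpow_mul_rpow_neg s (Matrix.isStrictlyPositive_iff_posDef.2 hA)

lemma opNorm_matPow_le {n : ℕ} {A B : Mat n} (hA : A.PosDef) (hB : B.PosDef) {p q : ℝ}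
    (hq : 0 < q) (hqp : q ≤ p) :
    opNorm (matPow A (1/p) * matPow B (-(1/p))) ≤
      opNorm (matPow A (1/q) * matPow B (-(1/q))) ^ (q/p) := by
  have hp : 0 < p := hq.trans_le hqp
  have hA' := Matrix.isStrictlyPositive_iff_posDef.2 hA
  have hB' := Matrix.isStrictlyPositive_iff_posDef.2 hB
  have key := norm_rpow_mul_rpow_le (a := A ^ (1/q)) (b := B ^ (-(1/q)))
    (IsStrictlyPositive.rpow A _ hA') (IsStrictlyPositive.rpow B _ hB') (s := q / p)
    (by positivity) ((div_le_one hp).2 hqp)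
  rw [CFC.rpow_rpow A _ _ (by positivity) hA',
    CFC.rpow_rpow B _ _ (by simp [hq.ne']) hB',
    show 1 / q * (q / p) = 1 / p by field_simp,
    show -(1 / q) * (q / p) = -(1 / p) by field_simp] at key
  rw [matPow_eq_rpow hA, matPow_eq_rpow hB, matPow_eq_rpow hA, matPow_eq_rpow hB]
  exact key

lemma continuousOn_matPow {n : ℕ} (s : ℝ) :
    ContinuousOn (fun A : Mat n => matPow A s) {A | A.PosDef} := by
  refine ContinuousOn.congr (f := fun A : Mat n => cfc (fun x : ℝ => x ^ s) A) ?_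
    fun A hA => matPow_eq_cfc hA.1 s
  refine ContinuousOn.cfc_of_mem_nhdsSet (s := Set.Ioi 0) _ ?_ continuousOn_id
    (fun A hA => hA.1) (fun x hx => (Real.continuousAt_rpow_const _ _
      (Or.inl (Set.mem_Ioi.1 hx).ne')).continuousWithinAt)
  refine isOpen_Ioi.mem_nhdsSet.2 (Set.iUnion₂_subset fun A hA x hx => ?_)
  exact (Matrix.isStrictlyPositive_iff_posDef.2 hA).spectrum_pos hx

end MatrixPowers

lemma measurableSet_posDef {n : ℕ} : MeasurableSet[borel (Mat n)] {A : Mat n | A.PosDef} := by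
  let _ : MeasurableSpace (Mat n) := borel _
  have : BorelSpace (Mat n) := ⟨rfl⟩
  have h : {A : Mat n | A.PosDef} =
      ({A | A.IsHermitian} ∩ ⋂ x : Fin n → ℂ, {A | 0 ≤ star x ⬝ᵥ A.mulVec x}) ∩ {A | A.det ≠ 0} := by
    ext A
    simp only [Set.mem_ofPred_eq, Set.mem_inter_iff, Set.mem_iInter]
    rw [← Matrix.posSemidef_iff_dotProduct_mulVec]
    exact ⟨fun h => ⟨h.posSemidef, h.det_pos.ne'⟩, fun h => h.1.posDef_iff_det_ne_zero.2 h.2⟩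
  rw [h]
  refine (((isClosed_eq (by fun_prop) (by fun_prop)).inter (isClosed_iInter fun x => ?_)).measurableSet).inter
    (isOpen_ne_fun (by fun_prop) continuous_const).measurableSet
  exact isClosed_le continuous_const (by fun_prop)

lemma exists_measurable_matPow {d n : ℕ} {W : Rd d → Mat n} (hW : IsMatrixWeight W) (s : ℝ) :
    ∃ B : Rd d → Mat n, (∀ i j, Measurable fun x => B x i j) ∧
      ∀ᵐ x, B x = matPow (W x) s := by
  classical
  let _ : MeasurableSpace (Mat n) := borel _
  have : BorelSpace (Mat n) := ⟨rfl⟩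
  have hWm : Measurable W := by
    have : BorelSpace (Fin n → Fin n → ℂ) := inferInstance
    have h : Measurable (fun x => (fun i j => W x i j : Fin n → Fin n → ℂ)) :=
      measurable_pi_lambda _ fun i => measurable_pi_lambda _ fun j => hW.1 i j
    intro t ht
    refine h (?_ : @MeasurableSet _ MeasurableSpace.pi t)
    rw [this.measurable_eq]; exact ht
  have hm : Measurable ({A : Mat n | A.PosDef}.piecewise (fun A => matPow A s) (fun _ => 1)) := by
    refine measurable_of_restrict_of_restrict_compl measurableSet_posDef ?_ ?_
    · rw [Set.domRestrict_piecewise]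
      exact (continuousOn_iff_continuous_domRestrict.1 (continuousOn_matPow s)).measurable
    · rw [Set.domRestrict_piecewise_compl]
      exact measurable_const
  refine ⟨fun x => ({A : Mat n | A.PosDef}.piecewise (fun A => matPow A s) (fun _ => 1)) (W x), fun i j => ?_, ?_⟩
  · exact ((Continuous.matrix_elem (A := fun A : Mat n => A) continuous_id i j).measurable.comp
      (hm.comp hWm) :)
  · filter_upwards [hW.2] with x hx
    exact Set.piecewise_eq_of_mem _ _ _ hx

section Cells

variable {X ι : Type*} [MeasurableSpace X] {μ : Measure X}

/-- The average of a function over a set. -/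
def avgOn (μ : Measure X) (S : Set X) (u : X → ℝ≥0∞) : ℝ≥0∞ := (μ S)⁻¹ * ∫⁻ y in S, u y ∂μ

/-- The fibre through `x` of the `k`-th partition in a sequence of partitions. -/
def cell (c : ℕ → X → ι) (k : ℕ) (x : X) : Set X := c k ⁻¹' {c k x}

/-- A refining sequence of countable measurable partitions into cells of positive finite measure,
given by the functions that label the cells. -/
structure IsNested [MeasurableSpace ι] (μ : Measure X) (c : ℕ → X → ι) : Prop where
  meas : ∀ k, Measurable (c k)
  refine : ∀ k x y, c (k + 1) x = c (k + 1) y → c k x = c k y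
  ne_zero : ∀ k x, μ (cell c k x) ≠ 0
  ne_top : ∀ k x, μ (cell c k x) ≠ ⊤

lemma mem_cell_iff {X ι : Type*} {c : ℕ → X → ι} {k : ℕ} {x y : X} : y ∈ cell c k x ↔ c k y = c k x := Iff.rfl

lemma cell_congr {X ι : Type*} {c : ℕ → X → ι} {k : ℕ} {x y : X} (h : c k x = c k y) :
    cell c k x = cell c k y := by rw [cell, cell, h]

variable [MeasurableSpace ι]

lemma IsNested.eq_of_le {c : ℕ → X → ι} (hc : IsNested μ c) {j k : ℕ} (hjk : j ≤ k) {x y : X}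
    (h : c k x = c k y) : c j x = c j y := by
  induction k, hjk using Nat.le_induction with
  | base => exact h
  | succ k _ ih => exact ih (hc.refine k x y h)

lemma IsNested.shift {c : ℕ → X → ι} (hc : IsNested μ c) (j : ℕ) :
    IsNested μ (fun k => c (j + k)) where
  meas _ := hc.meas _
  refine k := hc.refine (j + k)
  ne_zero k := hc.ne_zero (j + k)
  ne_top k := hc.ne_top (j + k)

lemma IsNested.measurableSet_cell [MeasurableSingletonClass ι] {c : ℕ → X → ι}
    (hc : IsNested μ c) (k : ℕ) (x : X) :
    MeasurableSet (cell c k x) := hc.meas k (measurableSet_singleton _)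

variable [Countable ι] [MeasurableSingletonClass ι]

lemma IsNested.measurable_of_const {α : Type*} [MeasurableSpace α] [Nonempty α] {c : ℕ → X → ι}
    (hc : IsNested μ c) {k : ℕ} {f : X → α} (hf : ∀ x y, c k x = c k y → f x = f y) :
    Measurable f := by
  obtain ⟨θ, hθ⟩ := (Function.factorsThrough_iff f (f := c k)).1 fun x y h => hf x y h
  rw [hθ]
  exact (measurable_of_countable θ).comp (hc.meas k)

lemma IsNested.measurableSet_of_const {c : ℕ → X → ι}
    (hc : IsNested μ c) {k : ℕ} {p : X → Prop} (hp : ∀ x y, c k x = c k y → (p x ↔ p y)) :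
    MeasurableSet {x | p x} :=
  measurableSet_setOfPred.2 (hc.measurable_of_const (f := p) fun x y h => propext (hp x y h))

lemma lintegral_eq_tsum_fiber {c : X → ι} (hc : Measurable c) (h : X → ℝ≥0∞) :
    ∫⁻ x, h x ∂μ = ∑' m, ∫⁻ x in c ⁻¹' {m}, h x ∂μ := by
  rw [← lintegral_iUnion (fun m => hc (measurableSet_singleton m))
    (fun i j hij => Set.disjoint_left.2 fun x hx hx' => hij (hx.symm.trans hx'))]
  rw [← Set.preimage_iUnion, Set.iUnion_of_singleton, Set.preimage_univ, Measure.restrict_univ]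

lemma IsNested.lintegral_mul_le {c : ℕ → X → ι} (hc : IsNested μ c) (k : ℕ) {θ h h' : X → ℝ≥0∞}
    (hθ : ∀ x y, c k x = c k y → θ x = θ y) (hh : Measurable h) (hh' : Measurable h')
    (hle : ∀ x, θ x ≠ 0 → ∫⁻ y in cell c k x, h y ∂μ ≤ ∫⁻ y in cell c k x, h' y ∂μ) :
    ∫⁻ x, θ x * h x ∂μ ≤ ∫⁻ x, θ x * h' x ∂μ := by
  rw [lintegral_eq_tsum_fiber (hc.meas k), lintegral_eq_tsum_fiber (hc.meas k)]
  refine ENNReal.tsum_le_tsum fun m => ?_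
  by_cases hm : ∃ x, c k x = m
  · obtain ⟨x, rfl⟩ := hm
    have key : ∀ g : X → ℝ≥0∞, Measurable g → ∫⁻ y in c k ⁻¹' {c k x}, θ y * g y ∂μ =
        θ x * ∫⁻ y in cell c k x, g y ∂μ := fun g hg => by
      rw [← lintegral_const_mul _ hg]
      exact setLIntegral_congr_fun (hc.measurableSet_cell k x) fun y hy => by
        simp only [hθ y x hy]
    rw [key h hh, key h' hh']
    by_cases h0 : θ x = 0
    · simp [h0]
    · exact mul_le_mul' le_rfl (hle x h0)
  · have : c k ⁻¹' {m} = ∅ := Set.eq_empty_of_forall_notMem fun x hx => hm ⟨x, hx⟩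
    simp [this]

lemma mul_measure_le_of_lt_avgOn {S : Set X} {u : X → ℝ≥0∞} {t : ℝ≥0∞} (h0 : μ S ≠ 0)
    (h1 : μ S ≠ ⊤) (h : t ≤ avgOn μ S u) : t * μ S ≤ ∫⁻ y in S, u y ∂μ := by
  calc t * μ S ≤ avgOn μ S u * μ S := by gcongr
    _ = _ := by rw [avgOn, mul_right_comm, ENNReal.inv_mul_cancel h0 h1, one_mul]

lemma IsNested.weak_type {c : ℕ → X → ι} (hc : IsNested μ c) {u : X → ℝ≥0∞} (hu : Measurable u)
    (t : ℝ≥0∞) : t * μ {x | ∃ k, t < avgOn μ (cell c k x) u} ≤ ∫⁻ x, u x ∂μ := by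
  set E : ℕ → Set X := fun k =>
    {x | t < avgOn μ (cell c k x) u ∧ ∀ l < k, ¬ t < avgOn μ (cell c l x) u} with hE
  have hconst : ∀ k x y, c k x = c k y → (x ∈ E k ↔ y ∈ E k) := fun k x y h => by
    simp only [hE, Set.mem_ofPred_eq, cell_congr h]
    refine and_congr_right fun _ => forall₂_congr fun l hl => ?_
    rw [cell_congr (hc.eq_of_le hl.le h)]
  have hEm : ∀ k, MeasurableSet (E k) := fun k => hc.measurableSet_of_const (hconst k)
  have hEd : Pairwise (Function.onFun Disjoint E) := by
    intro i j hij
    refine Set.disjoint_left.2 fun x hx hx' => ?_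
    rcases lt_or_gt_of_ne hij with h | h
    · exact hx'.2 i h hx.1
    · exact hx.2 j h hx'.1
  have hU : {x | ∃ k, t < avgOn μ (cell c k x) u} ⊆ ⋃ k, E k := by
    classical
    intro x hx
    exact Set.mem_iUnion.2 ⟨Nat.find hx, Nat.find_spec hx, fun l hl => Nat.find_min hx hl⟩
  have hk : ∀ k, t * μ (E k) ≤ ∫⁻ x in E k, u x ∂μ := fun k => by
    have := hc.lintegral_mul_le k (θ := (E k).indicator 1) (h := fun _ => t) (h' := u)
      (fun x y h => by
        classical
        simp only [Set.indicator_apply, hconst k x y h, Pi.one_apply]) measurable_const hu (fun x hx => by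
        rw [setLIntegral_const]
        refine mul_measure_le_of_lt_avgOn (hc.ne_zero k x) (hc.ne_top k x) ?_
        exact (Set.mem_of_indicator_ne_zero hx).1.le)
    have e : ∀ g : X → ℝ≥0∞, ∫⁻ x, (E k).indicator 1 x * g x ∂μ = ∫⁻ x in E k, g x ∂μ :=
      fun g => by
        rw [← lintegral_indicator (hEm k)]
        congr with x
        by_cases hx : x ∈ E k <;> simp [hx]
    rw [e, e, setLIntegral_const] at this
    exact this
  calc t * μ {x | ∃ k, t < avgOn μ (cell c k x) u} ≤ t * μ (⋃ k, E k) := by gcongr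
    _ ≤ t * ∑' k, μ (E k) := by gcongr; exact measure_iUnion_le _
    _ = ∑' k, t * μ (E k) := ENNReal.tsum_mul_left.symm
    _ ≤ ∑' k, ∫⁻ x in E k, u x ∂μ := ENNReal.tsum_le_tsum hk
    _ = ∫⁻ x in ⋃ k, E k, u x ∂μ := (lintegral_iUnion hEm hEd _).symm
    _ ≤ _ := setLIntegral_le_lintegral _ _

lemma IsNested.weak_type_cell {c : ℕ → X → ι} (hc : IsNested μ c) {u : X → ℝ≥0∞}
    (hu : Measurable u) (j : ℕ) (x₀ : X) {C v : ℝ≥0∞} (hC : C ≠ 0)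
    (hv : avgOn μ (cell c j x₀) u ≤ v) :
    C * μ {x ∈ cell c j x₀ | ∃ k, j ≤ k ∧ C * v < avgOn μ (cell c k x) u} ≤
      μ (cell c j x₀) := by
  set Q := cell c j x₀ with hQ
  have hQm : MeasurableSet Q := hc.measurableSet_cell j x₀
  have h_int : ∫⁻ x in Q, u x ∂μ ≤ v * μ Q := by
    rw [avgOn, mul_comm, ← div_eq_mul_inv] at hv
    exact (ENNReal.div_le_iff (hc.ne_zero j x₀) (hc.ne_top j x₀)).1 hv
  have hsub : ∀ k x, x ∈ Q → j ≤ k → cell c k x ⊆ Q := fun k x hx hjk y hy =>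
    (hc.eq_of_le hjk hy).trans hx
  rcases eq_or_ne v ⊤ with rfl | hvt
  · simp [ENNReal.mul_top hC]
  rcases eq_or_ne v 0 with rfl | hv0
  · have : {x ∈ Q | ∃ k, j ≤ k ∧ C * 0 < avgOn μ (cell c k x) u} = ∅ := by
      refine Set.eq_empty_of_forall_notMem fun x hx => ?_
      obtain ⟨hxQ, k, hjk, hk⟩ := hx
      have h0 : ∫⁻ x in cell c k x, u x ∂μ = 0 := le_antisymm
        ((lintegral_mono_set (hsub k x hxQ hjk)).trans (h_int.trans (by simp))) zero_le
      simp [avgOn, h0] at hk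
    rw [this, measure_empty, mul_zero]
    exact zero_le
  have hw := (hc.shift j).weak_type (hu.indicator hQm) (C * v)
  rw [lintegral_indicator hQm] at hw
  have hss : {x ∈ Q | ∃ k, j ≤ k ∧ C * v < avgOn μ (cell c k x) u} ⊆
      {x | ∃ k, C * v < avgOn μ (cell (fun k => c (j + k)) k x) (Q.indicator u)} := by
    rintro x ⟨hxQ, k, hjk, hk⟩
    refine ⟨k - j, ?_⟩
    have e : cell (fun k => c (j + k)) (k - j) x = cell c k x := by
      simp only [cell, Nat.add_sub_cancel' hjk]
    rw [e, avgOn, setLIntegral_congr_fun (hc.measurableSet_cell k x)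
      (g := u) (fun y hy => Set.indicator_of_mem (hsub k x hxQ hjk hy) u)]
    exact hk
  have h3 : v * (C * μ {x ∈ Q | ∃ k, j ≤ k ∧ C * v < avgOn μ (cell c k x) u}) ≤ v * μ Q :=
    calc _ = C * v * μ {x ∈ Q | ∃ k, j ≤ k ∧ C * v < avgOn μ (cell c k x) u} := by ring
      _ ≤ _ := by gcongr
      _ ≤ _ := hw.trans h_int
  exact (ENNReal.mul_le_mul_iff_right hv0 hvt).1 h3

end Cells

lemma rpow_le_tsum_zpow {s : ℝ} (hs : 0 < s) (v : ℝ≥0∞) :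
    v ^ s ≤ ∑' m : ℤ, ((2 : ℝ≥0∞) ^ (m + 1)) ^ s * (Set.Ioi (2 ^ m)).indicator 1 v := by
  rcases eq_or_ne v 0 with rfl | h0
  · simp [ENNReal.zero_rpow_of_pos hs]
  rcases eq_or_ne v ⊤ with rfl | htop
  · refine le_trans (le_of_le_of_eq le_top
      (ENNReal.tsum_const_eq_top_of_ne_zero (α := ℕ) one_ne_zero).symm) ?_
    refine le_trans (ENNReal.tsum_le_tsum fun m => ?_) (ENNReal.tsum_comp_le_tsum_of_injective
      (Nat.cast_injective (R := ℤ)) _)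
    have h2 : (2 : ℝ≥0∞) ^ (m : ℤ) < ⊤ := by
      rw [zpow_natCast]; exact ENNReal.pow_lt_top ofNat_lt_top
    rw [Set.indicator_of_mem (Set.mem_Ioi.2 h2), Pi.one_apply, mul_one]
    refine ENNReal.one_le_rpow ?_ hs
    exact_mod_cast one_le_pow₀ (M₀ := ℝ≥0∞) (n := m + 1) one_le_two
  · obtain ⟨m, hm, hm'⟩ := ENNReal.exists_mem_Ioc_zpow h0 htop (y := 2) one_lt_two ofNat_ne_top
    refine le_trans ?_ (ENNReal.le_tsum m)
    rw [Set.indicator_of_mem (Set.mem_Ioi.2 hm), Pi.one_apply, mul_one]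
    gcongr

lemma exists_tsum_zpow_le {a : ℝ} (ha : 0 < a) : ∃ C : ℝ≥0∞, C ≠ ⊤ ∧ ∀ v : ℝ≥0∞,
    ∑' m : ℤ, ((2 : ℝ≥0∞) ^ m) ^ a * (Set.Ioi (2 ^ m)).indicator 1 v ≤ C * v ^ a := by
  have hρ : (2 : ℝ≥0∞) ^ (-a) < 1 := ENNReal.rpow_lt_one_of_one_lt_of_neg one_lt_two (by linarith)
  have hC : ∑' j : ℕ, ((2 : ℝ≥0∞) ^ (-a)) ^ j ≠ ⊤ := by
    rw [ENNReal.tsum_geometric, Ne, ENNReal.inv_eq_top, tsub_eq_zero_iff_le, not_le]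
    exact hρ
  refine ⟨1 + ∑' j : ℕ, ((2 : ℝ≥0∞) ^ (-a)) ^ j, ENNReal.add_ne_top.2 ⟨one_ne_top, hC⟩, fun v => ?_⟩
  rcases eq_or_ne v 0 with rfl | h0
  · simp
  rcases eq_or_ne v ⊤ with rfl | htop
  · rw [ENNReal.top_rpow_of_pos ha, ENNReal.mul_top (by simp)]
    exact le_top
  obtain ⟨M, hM, hM'⟩ := ENNReal.exists_mem_Ioc_zpow h0 htop (y := 2) one_lt_two ofNat_ne_top
  have hinj : Function.Injective fun j : ℕ => M - (j : ℤ) := fun i j h => by simpa using h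
  rw [← hinj.tsum_eq]
  · calc _ ≤ ∑' j : ℕ, v ^ a * ((2 : ℝ≥0∞) ^ (-a)) ^ j := ENNReal.tsum_le_tsum fun j => ?_
      _ = v ^ a * ∑' j : ℕ, ((2 : ℝ≥0∞) ^ (-a)) ^ j := ENNReal.tsum_mul_left
      _ ≤ _ := by rw [mul_comm]; gcongr; exact le_add_self
    have e : ((2 : ℝ≥0∞) ^ (M - (j : ℤ))) ^ a = ((2 : ℝ≥0∞) ^ M) ^ a * ((2 : ℝ≥0∞) ^ (-a)) ^ j := by
      simp only [← ENNReal.rpow_intCast, ← ENNReal.rpow_natCast, ← ENNReal.rpow_mul]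
      rw [← ENNReal.rpow_add _ _ two_ne_zero ofNat_ne_top]
      congr 1
      push_cast
      ring
    rw [e]
    calc _ ≤ ((2 : ℝ≥0∞) ^ M) ^ a * ((2 : ℝ≥0∞) ^ (-a)) ^ j * 1 := by
          gcongr
          exact Set.indicator_le_self' (by simp) v |>.trans (by simp)
      _ ≤ _ := by rw [mul_one]; gcongr
  · intro m hm
    have h1 : (2 : ℝ≥0∞) ^ m < v := by
      by_contra h
      exact hm (by simp [h])
    have h2 : m < M + 1 := by
      by_contra h
      exact absurd (h1.trans_le hM') (not_lt.2 (ENNReal.zpow_le_of_le one_le_two (not_lt.1 h)))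
    exact ⟨(M - m).toNat, by simp only; omega⟩

section Cells
variable {X ι : Type*} [MeasurableSpace X] {μ : Measure X}
variable [MeasurableSpace ι] [Countable ι] [MeasurableSingletonClass ι]

lemma IsNested.measurable_avgOn {c : ℕ → X → ι} (hc : IsNested μ c) (k : ℕ) (u : X → ℝ≥0∞) :
    Measurable fun x => avgOn μ (cell c k x) u :=
  hc.measurable_of_const (k := k) fun x y h => by rw [cell_congr h]

lemma IsNested.half_mul_measure_le {c : ℕ → X → ι} (hc : IsNested μ c) {u : X → ℝ≥0∞}
    (hu : Measurable u) (t : ℝ≥0∞) :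
    t / 2 * μ {x | t < ⨆ k, avgOn μ (cell c k x) u} ≤
      ∫⁻ x, u x * (Set.Ioi t).indicator 1 (2 * u x) ∂μ := by
  have hm : Measurable fun x => u x * (Set.Ioi t).indicator 1 (2 * u x) :=
    hu.mul ((measurable_one.indicator measurableSet_Ioi).comp (hu.const_mul 2))
  refine le_trans ?_ (hc.weak_type hm (t / 2))
  gcongr
  rintro ht'
  obtain ⟨k, hk⟩ := lt_iSup_iff.1 ht'
  refine ⟨k, ?_⟩
  rename_i x
  by_contra! h
  refine absurd hk (not_lt.2 ?_)
  have hle : ∀ y, u y ≤ u y * (Set.Ioi t).indicator 1 (2 * u y) + t / 2 := fun y => by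
    by_cases hy : t < 2 * u y
    · simp [hy]
    · refine le_add_of_nonneg_of_le zero_le ?_
      rw [ENNReal.le_div_iff_mul_le (by simp) (by simp), mul_comm]
      exact not_lt.1 hy
  calc avgOn μ (cell c k x) u ≤ (μ (cell c k x))⁻¹ * ∫⁻ y in cell c k x,
        (u y * (Set.Ioi t).indicator 1 (2 * u y) + t / 2) ∂μ := by
        unfold avgOn
        gcongr with y
        exact hle y
    _ = avgOn μ (cell c k x) (fun y => u y * (Set.Ioi t).indicator 1 (2 * u y)) + t / 2 := by
        rw [lintegral_add_left hm, mul_add, setLIntegral_const, mul_left_comm,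
          ENNReal.inv_mul_cancel (hc.ne_zero k x) (hc.ne_top k x), mul_one, avgOn]
    _ ≤ t / 2 + t / 2 := by gcongr
    _ = t := ENNReal.add_halves t

/-- The strong type estimate for the maximal operator of a nested sequence of partitions. -/
theorem exists_lintegral_iSup_avgOn_rpow_le {s : ℝ} (hs : 1 < s) : ∃ C : ℝ≥0∞, C ≠ ⊤ ∧
    ∀ {X ι : Type} [MeasurableSpace X] {μ : Measure X} [MeasurableSpace ι] [Countable ι]
      [MeasurableSingletonClass ι] {c : ℕ → X → ι}, IsNested μ c → ∀ {u : X → ℝ≥0∞}, Measurable u →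
      ∫⁻ x, (⨆ k, avgOn μ (cell c k x) u) ^ s ∂μ ≤ C * ∫⁻ x, u x ^ s ∂μ := by
  obtain ⟨C, hC, hCle⟩ := exists_tsum_zpow_le (a := s - 1) (by linarith)
  refine ⟨2 ^ (s + 1) * C * 2 ^ (s - 1), ?_, ?_⟩
  · have h2 : ∀ r : ℝ, (2 : ℝ≥0∞) ^ r ≠ ⊤ := fun r =>
      ENNReal.rpow_ne_top_of_ne_zero two_ne_zero ofNat_ne_top
    exact ENNReal.mul_ne_top (ENNReal.mul_ne_top (h2 _) hC) (h2 _)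
  intro X ι _ μ _ _ _ c hc u hu
  have hs0 : 0 < s := by linarith
  set S : X → ℝ≥0∞ := fun x => ⨆ k, avgOn μ (cell c k x) u with hS
  have hSm : Measurable S := Measurable.iSup fun k => hc.measurable_avgOn k u
  have hmeas : ∀ m : ℤ, Measurable fun x => u x * (Set.Ioi ((2 : ℝ≥0∞) ^ m)).indicator 1 (2 * u x) :=
    fun m => hu.mul ((measurable_one.indicator measurableSet_Ioi).comp (hu.const_mul 2))
  have hmeas' : ∀ (m : ℤ) {h : X → ℝ≥0∞}, Measurable h →
      Measurable fun x => (Set.Ioi ((2 : ℝ≥0∞) ^ m)).indicator (1 : ℝ≥0∞ → ℝ≥0∞) (h x) :=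
    fun m h hh => (measurable_one.indicator measurableSet_Ioi).comp hh
  calc ∫⁻ x, S x ^ s ∂μ
      ≤ ∫⁻ x, ∑' m : ℤ, ((2 : ℝ≥0∞) ^ (m + 1)) ^ s * (Set.Ioi (2 ^ m)).indicator 1 (S x) ∂μ :=
        lintegral_mono fun x => rpow_le_tsum_zpow hs0 _
    _ = ∑' m : ℤ, ((2 : ℝ≥0∞) ^ (m + 1)) ^ s * μ {x | 2 ^ m < S x} := by
        rw [lintegral_tsum fun m => ((hmeas' m hSm).const_mul _).aemeasurable]
        congr with m
        rw [lintegral_const_mul _ (hmeas' m hSm)]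
        congr 1
        rw [← lintegral_indicator_one (measurableSet_lt measurable_const hSm)]
        rfl
    _ ≤ ∑' m : ℤ, 2 ^ (s + 1) * (((2 : ℝ≥0∞) ^ m) ^ (s - 1) *
          ∫⁻ x, u x * (Set.Ioi ((2 : ℝ≥0∞) ^ m)).indicator 1 (2 * u x) ∂μ) := by
        refine ENNReal.tsum_le_tsum fun m => ?_
        have e : ((2 : ℝ≥0∞) ^ (m + 1)) ^ s =
            2 ^ (s + 1) * (((2 : ℝ≥0∞) ^ m) ^ (s - 1) * (2 ^ m / 2)) := by
          have h2 : (2 : ℝ≥0∞)⁻¹ = 2 ^ (-1 : ℝ) := by rw [ENNReal.rpow_neg_one]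
          rw [div_eq_mul_inv, h2]
          simp only [← ENNReal.rpow_intCast, ← ENNReal.rpow_mul]
          simp only [← ENNReal.rpow_add _ _ two_ne_zero ofNat_ne_top]
          congr 1
          push_cast
          ring
        rw [e, mul_assoc, mul_assoc]
        gcongr
        exact hc.half_mul_measure_le hu _
    _ = 2 ^ (s + 1) * ∫⁻ x, u x * ∑' m : ℤ, ((2 : ℝ≥0∞) ^ m) ^ (s - 1) *
          (Set.Ioi ((2 : ℝ≥0∞) ^ m)).indicator 1 (2 * u x) ∂μ := by
        rw [ENNReal.tsum_mul_left]
        congr 1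
        simp_rw [← ENNReal.tsum_mul_left]
        rw [lintegral_tsum fun m => (hu.fun_mul
          ((hmeas' m (hu.const_mul 2)).const_mul _)).aemeasurable]
        congr with m
        rw [← lintegral_const_mul _ (hmeas m)]
        congr with x
        ring
    _ ≤ 2 ^ (s + 1) * ∫⁻ x, C * 2 ^ (s - 1) * u x ^ s ∂μ := by
        refine mul_le_mul' le_rfl (lintegral_mono fun x => ?_)
        calc _ ≤ u x * (C * (2 * u x) ^ (s - 1)) := by gcongr; exact hCle _
          _ = C * 2 ^ (s - 1) * (u x * u x ^ (s - 1)) := by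
            rw [ENNReal.mul_rpow_of_nonneg _ _ (by linarith)]
            ring
          _ = _ := by
            have h1 := ENNReal.rpow_add_of_nonneg (x := u x) 1 (s - 1) zero_le_one (by linarith)
            rw [ENNReal.rpow_one, add_sub_cancel] at h1
            rw [h1]
    _ = _ := by rw [lintegral_const_mul _ (hu.pow_const s)]; ring

end Cells

section Cells

open Classical in
/-- The last stopping generation up to `k`, where generation `k` is a stopping generation if it is
bad relative to the previous stopping generation. -/
def lastStop {X : Type*} (bad : ℕ → ℕ → X → Prop) : ℕ → X → ℕ
  | 0, _ => 0
  | k + 1, x => if bad (lastStop bad k x) (k + 1) x then k + 1 else lastStop bad k x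

section LastStop

variable {X : Type*} {bad : ℕ → ℕ → X → Prop}

lemma lastStop_le (k : ℕ) (x : X) : lastStop bad k x ≤ k := by
  induction k with
  | zero => exact le_rfl
  | succ k ih => rw [lastStop]; split_ifs <;> omega

lemma not_bad_lastStop (h0 : ∀ j x, ¬ bad j j x) (k : ℕ) (x : X) :
    ¬ bad (lastStop bad k x) k x := by
  cases k with
  | zero => exact h0 0 x
  | succ k =>
    rw [lastStop]
    split_ifs with h
    · exact h0 _ x
    · exact h

lemma lastStop_lastStop (k : ℕ) (x : X) : lastStop bad (lastStop bad k x) x = lastStop bad k x := by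
  induction k with
  | zero => rfl
  | succ k ih =>
    by_cases h : bad (lastStop bad k x) (k + 1) x
    · simp only [lastStop, if_pos h]
    · simp only [lastStop, if_neg h, ih]

lemma lastStop_eq_of_forall_not_bad {j k : ℕ} (hjk : j ≤ k) {x : X} (hj : lastStop bad j x = j)
    (h : ∀ l, j ≤ l → ¬ bad j l x) : lastStop bad k x = j := by
  induction k, hjk using Nat.le_induction with
  | base => exact hj
  | succ k hk ih => rw [lastStop, ih, if_neg (h _ (by omega))]

end LastStop

variable {X ι : Type*} [MeasurableSpace X] {μ : Measure X} [MeasurableSpace ι]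

lemma IsNested.lastStop_congr {c : ℕ → X → ι} (hc : IsNested μ c) {bad : ℕ → ℕ → X → Prop}
    (hbad : ∀ j k x y, j ≤ k → c k x = c k y → (bad j k x ↔ bad j k y)) (k : ℕ) {x y : X}
    (h : c k x = c k y) : lastStop bad k x = lastStop bad k y := by
  induction k with
  | zero => rfl
  | succ k ih =>
    have h' := ih (hc.eq_of_le k.le_succ h)
    have hb := hbad (lastStop bad k y) (k + 1) x y ((lastStop_le k y).trans k.le_succ) h
    classical
    rw [lastStop, lastStop, h']
    exact if_congr hb rfl rfl

variable [Countable ι] [MeasurableSingletonClass ι]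

/-- A Carleson embedding along a sparse family of stopping cells. -/
theorem IsNested.lintegral_iSup_mul_le {c : ℕ → X → ι} (hc : IsNested μ c)
    {F a : ℕ → X → ℝ≥0∞} {bad : ℕ → ℕ → X → Prop} {K D : ℝ≥0∞}
    (hbad : ∀ j k x y, j ≤ k → c k x = c k y → (bad j k x ↔ bad j k y))
    (hbad0 : ∀ j x, ¬ bad j j x)
    (hsparse : ∀ j x, 2 * μ {y ∈ cell c j x | ∃ k, j ≤ k ∧ bad j k y} ≤ μ (cell c j x))
    (hF : ∀ k x y, c k x = c k y → F k x = F k y) (ha : ∀ k, Measurable (a k))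
    (haK : ∀ k x, ∫⁻ y in cell c k x, a k y ∂μ ≤ K * μ (cell c k x))
    (hgood : ∀ j k x, j ≤ k → ¬ bad j k x → a k x * F k x ≤ D * (a j x * F j x)) :
    ∫⁻ x, ⨆ k, a k x * F k x ∂μ ≤ 2 * D * K * ∫⁻ x, ⨆ k, F k x ∂μ := by
  classical
  set G : ℕ → Set X := fun j => {x | ∀ l, j ≤ l → ¬ bad j l x} with hG
  set θ : ℕ → X → ℝ≥0∞ := fun j x => (if lastStop bad j x = j then 1 else 0) * F j x with hθdef
  have hFm : ∀ k, Measurable (F k) := fun k => hc.measurable_of_const (hF k)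
  have hθ : ∀ j x y, c j x = c j y → θ j x = θ j y := fun j x y h => by
    simp only [hθdef, hc.lastStop_congr hbad j h, hF j x y h]
  have hθm : ∀ k, Measurable (θ k) := fun k => hc.measurable_of_const (hθ k)
  have hGm : ∀ j, MeasurableSet (G j) := fun j => by
    have : G j = ⋂ l, ⋂ _ : j ≤ l, {x | ¬ bad j l x} := by
      ext x; simp [hG]
    rw [this]
    exact MeasurableSet.iInter fun l => MeasurableSet.iInter fun hl =>
      hc.measurableSet_of_const (k := l) fun x y h => not_congr (hbad j l x y hl h)
  have hGm' : ∀ j, Measurable ((G j).indicator (1 : X → ℝ≥0∞)) := fun j =>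
    measurable_one.indicator (hGm j)
  have hcell : ∀ j x, μ (cell c j x) ≤ 2 * μ (cell c j x ∩ G j) := fun j x => by
    have hsub : cell c j x \ G j ⊆ {y ∈ cell c j x | ∃ k, j ≤ k ∧ bad j k y} := fun y hy => by
      have h2 := hy.2
      simp only [hG, Set.mem_ofPred_eq, not_forall, not_not] at h2
      obtain ⟨k, hk, hb⟩ := h2
      exact ⟨hy.1, k, hk, hb⟩
    have h1 := measure_inter_add_sdiff (μ := μ) (cell c j x) (hGm j)
    have h2 : 2 * μ (cell c j x \ G j) ≤ μ (cell c j x) :=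
      (mul_le_mul' le_rfl (measure_mono hsub)).trans (hsparse j x)
    refine (ENNReal.add_le_add_iff_right (hc.ne_top j x)).1 ?_
    calc μ (cell c j x) + μ (cell c j x) = 2 * (μ (cell c j x ∩ G j) + μ (cell c j x \ G j)) := by
          rw [h1, two_mul]
      _ = 2 * μ (cell c j x ∩ G j) + 2 * μ (cell c j x \ G j) := mul_add _ _ _
      _ ≤ _ := by gcongr
  have hpt : ∀ x, ⨆ k, a k x * F k x ≤ D * ∑' j, θ j x * a j x := fun x => by
    refine iSup_le fun k => ?_
    refine (hgood (lastStop bad k x) k x (lastStop_le k x) (not_bad_lastStop hbad0 k x)).trans ?_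
    refine mul_le_mul' le_rfl (le_trans (le_of_eq ?_) (ENNReal.le_tsum (lastStop bad k x)))
    simp only [hθdef, lastStop_lastStop, if_true, one_mul]
    rw [mul_comm]
  have hdisj : ∀ x, ∑' j, θ j x * (G j).indicator 1 x ≤ ⨆ k, F k x := fun x => by
    by_cases hx : ∃ j, lastStop bad j x = j ∧ x ∈ G j
    · obtain ⟨j, hj, hjG⟩ := hx
      rw [tsum_eq_single j]
      · simp only [hθdef, hj, if_true, one_mul, Set.indicator_of_mem hjG, Pi.one_apply, mul_one]
        exact le_iSup (fun k => F k x) j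
      · intro i hij
        by_contra h
        have hiG : x ∈ G i := Set.mem_of_indicator_ne_zero (right_ne_zero_of_mul h)
        have hi : lastStop bad i x = i := by
          by_contra h'
          exact h (by simp [hθdef, h'])
        rcases le_total i j with hle | hle
        · exact hij ((lastStop_eq_of_forall_not_bad hle hi hiG).symm.trans hj)
        · exact hij (hi.symm.trans (lastStop_eq_of_forall_not_bad hle hj hjG))
    · push Not at hx
      have : ∀ j, θ j x * (G j).indicator 1 x = 0 := fun j => by
        by_cases hj : lastStop bad j x = j
        · rw [Set.indicator_of_notMem (hx j hj), mul_zero]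
        · simp [hθdef, hj]
      simp [this]
  calc ∫⁻ x, ⨆ k, a k x * F k x ∂μ ≤ ∫⁻ x, D * ∑' j, θ j x * a j x ∂μ := lintegral_mono hpt
    _ = D * ∑' j, ∫⁻ x, θ j x * a j x ∂μ := by
        rw [lintegral_const_mul _ (Measurable.tsum fun j => (hθm j).fun_mul (ha j)),
          lintegral_tsum fun j => ((hθm j).fun_mul (ha j)).aemeasurable]
    _ ≤ D * ∑' j, 2 * K * ∫⁻ x, θ j x * (G j).indicator 1 x ∂μ := by
        refine mul_le_mul' le_rfl (ENNReal.tsum_le_tsum fun j => ?_)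
        rw [← lintegral_const_mul _ ((hθm j).fun_mul (hGm' j))]
        simp_rw [mul_left_comm (2 * K)]
        refine hc.lintegral_mul_le j (hθ j) (ha j) ((hGm' j).const_mul _) fun x _ => ?_
        rw [lintegral_const_mul _ (hGm' j), lintegral_indicator_one (hGm j),
          Measure.restrict_apply (hGm j), Set.inter_comm]
        calc _ ≤ K * μ (cell c j x) := haK j x
          _ ≤ K * (2 * μ (cell c j x ∩ G j)) := by gcongr; exact hcell j x
          _ = _ := by ring
    _ = 2 * D * K * ∫⁻ x, ∑' j, θ j x * (G j).indicator 1 x ∂μ := by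
        rw [lintegral_tsum fun j => ((hθm j).fun_mul (hGm' j)).aemeasurable, ENNReal.tsum_mul_left]
        ring
    _ ≤ _ := by gcongr with x; exact hdisj x

end Cells

/-- A bounded absorbing set contains a basis whose coordinates are bounded by `2` on that set. -/
lemma exists_basis_coord_le_two {n : ℕ} {S : Set (Vec n)} {R δ : ℝ} (hR : ∀ b ∈ S, ‖b‖ ≤ R)
    (hδ : 0 < δ) (hS : ∀ i, δ • EuclideanSpace.single i (1 : ℂ) ∈ S) :
    ∃ e : Fin n → Vec n, (∀ i, e i ∈ S) ∧
      ∀ b ∈ S, ∃ z : Fin n → ℂ, b = ∑ i, z i • e i ∧ ∀ i, ‖z i‖ ≤ 2 := by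
  set D : (Fin n → Vec n) → ℝ := fun e => ‖(Matrix.of fun i j => e j i).det‖ with hD
  set V : Set ℝ := D '' {e | ∀ i, e i ∈ S} with hV
  have hbdd : BddAbove V := by
    refine ⟨n.factorial • R ^ n, ?_⟩
    rintro _ ⟨e, he, rfl⟩
    have h := Matrix.det_le (A := Matrix.of fun i j => e j i) (abv := NormedField.toAbsoluteValue ℂ)
      (x := R) fun i j => ?_
    · rw [Fintype.card_fin] at h
      exact h
    · exact (PiLp.norm_apply_le (e j) i).trans (hR _ (he j))
  have hpos : 0 < sSup V := by
    refine lt_of_lt_of_le ?_ (le_csSup hbdd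
      ⟨fun i => δ • EuclideanSpace.single i (1 : ℂ), hS, rfl⟩)
    have h1 : (Matrix.of fun i j => (δ • EuclideanSpace.single j (1 : ℂ) : Vec n) i) =
        (δ : ℂ) • (1 : Mat n) := by
      ext i j
      by_cases h : i = j
      · subst h; simp
      · simp [h]
    simp only [hD, h1, Matrix.det_smul, Matrix.det_one, mul_one, norm_pow, Complex.norm_real]
    exact pow_pos (norm_pos_iff.2 hδ.ne') _
  have hne : V.Nonempty := ⟨_, fun i => δ • EuclideanSpace.single i (1 : ℂ), hS, rfl⟩
  obtain ⟨_, ⟨e, he, rfl⟩, hlt⟩ := exists_lt_of_lt_csSup hne (half_lt_self hpos)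
  refine ⟨e, he, fun b hb => ?_⟩
  set M : Mat n := Matrix.of fun i j => e j i with hM
  have hdet : 0 < ‖M.det‖ := (half_pos hpos).trans hlt
  refine ⟨fun i => M.cramer b i / M.det, ?_, fun i => ?_⟩
  · have h := Matrix.mulVec_cramer M b
    have hd0 : M.det ≠ 0 := norm_pos_iff.1 hdet
    ext i
    have hi := congrFun h i
    simp only [Matrix.mulVec, dotProduct, Pi.smul_apply, smul_eq_mul] at hi
    simp only [PiLp.smul_apply, smul_eq_mul, WithLp.ofLp_sum, Finset.sum_apply]
    rw [eq_comm, ← mul_right_inj' hd0, ← hi, Finset.mul_sum]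
    refine Finset.sum_congr rfl fun j _ => ?_
    change M.det * (M.cramer b j / M.det * M i j) = M i j * M.cramer b j
    rw [← mul_assoc, mul_div_cancel₀ _ hd0, mul_comm]
  · rw [norm_div, div_le_iff₀ hdet, Matrix.cramer_apply]
    have h1 : M.updateCol i b = Matrix.of fun k j => (Function.update e i b) j k := by
      ext k j
      by_cases h : j = i
      · subst h; simp
      · simp [h, hM]
    have h2 : D (Function.update e i b) ≤ sSup V := le_csSup hbdd
      ⟨_, fun j => by
        by_cases h : j = i
        · subst h; simpa using hb
        · simpa [h] using he j, rfl⟩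
    rw [h1]
    change D _ ≤ _
    change _ < ‖M.det‖ at hlt
    linarith

section Cells
variable {X ι : Type*} [MeasurableSpace X] {μ : Measure X} {n : ℕ}

/-- The average of `‖B e‖ ^ r` over a set. -/
def avgPow (μ : Measure X) (B : X → Mat n) (r : ℝ) (S : Set X) (e : Vec n) : ℝ≥0∞ :=
  avgOn μ S fun y => ‖mvec (B y) e‖ₑ ^ r

lemma measurable_mvec {B : X → Mat n} (hB : ∀ i j, Measurable fun x => B x i j) {e : X → Vec n}
    (he : ∀ i, Measurable fun x => e x i) : Measurable fun x => mvec (B x) (e x) := by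
  have h : Measurable fun x => WithLp.ofLp (mvec (B x) (e x)) := measurable_pi_lambda _ fun i => by
    simp only [mvec, Matrix.ofLp_toLpLin, Matrix.toLin'_apply, Matrix.mulVec, dotProduct]
    exact Finset.measurable_sum _ fun j _ => (hB i j).mul (he j)
  exact (WithLp.measurable_toLp 2 _).comp h

lemma avgOn_mono {S : Set X} {u v : X → ℝ≥0∞} (h : ∀ x, u x ≤ v x) : avgOn μ S u ≤ avgOn μ S v :=
  mul_le_mul' le_rfl (lintegral_mono h)

lemma avgOn_const_mul {S : Set X} {u : X → ℝ≥0∞} (hu : Measurable u) (C : ℝ≥0∞) :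
    avgOn μ S (fun x => C * u x) = C * avgOn μ S u := by
  rw [avgOn, lintegral_const_mul _ hu, mul_left_comm, avgOn]

lemma avgOn_sum {S : Set X} {κ : Type*} (s : Finset κ) {u : κ → X → ℝ≥0∞}
    (hu : ∀ i, Measurable (u i)) :
    avgOn μ S (fun x => ∑ i ∈ s, u i x) = ∑ i ∈ s, avgOn μ S (u i) := by
  rw [avgOn, lintegral_finsetSum _ fun i _ => hu i, Finset.mul_sum]
  rfl

lemma measurable_norm_mvec_rpow {B : X → Mat n} (hB : ∀ i j, Measurable fun x => B x i j) (r : ℝ)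
    (e : Vec n) : Measurable fun y => ‖mvec (B y) e‖ₑ ^ r :=
  (measurable_mvec hB fun _ => measurable_const).enorm.pow_const r

lemma avgPow_smul {B : X → Mat n} (hB : ∀ i j, Measurable fun x => B x i j) {r : ℝ} (hr : 0 ≤ r)
    (S : Set X) (z : ℂ) (e : Vec n) :
    avgPow μ B r S (z • e) = ‖z‖ₑ ^ r * avgPow μ B r S e := by
  rw [avgPow, avgPow, ← avgOn_const_mul (measurable_norm_mvec_rpow hB r e)]
  congr with y
  rw [mvec, map_smul, enorm_smul, ENNReal.mul_rpow_of_nonneg _ _ hr, mvec]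

lemma avgPow_sum_le {B : X → Mat n} (hB : ∀ i j, Measurable fun x => B x i j) {r : ℝ}
    (hr : 1 ≤ r) (S : Set X) (e : Fin n → Vec n) {z : Fin n → ℂ} {C : ℝ≥0∞} (hz : ∀ i, ‖z i‖ₑ ≤ 2)
    (hC : ∀ i, avgPow μ B r S (e i) ≤ C) :
    avgPow μ B r S (∑ i, z i • e i) ≤ 2 ^ r * (n : ℝ≥0∞) ^ r * C := by
  have hr0 : 0 ≤ r := by linarith
  calc avgPow μ B r S (∑ i, z i • e i)
      ≤ avgOn μ S fun y => (n : ℝ≥0∞) ^ (r - 1) * ∑ i, ‖mvec (B y) (z i • e i)‖ₑ ^ r := by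
        refine avgOn_mono fun y => ?_
        have h := ENNReal.rpow_sum_le_const_mul_sum_rpow (Finset.univ : Finset (Fin n))
          (fun i => ‖mvec (B y) (z i • e i)‖ₑ) hr
        rw [Finset.card_univ, Fintype.card_fin] at h
        refine le_trans ?_ h
        gcongr
        rw [mvec, map_sum]
        exact enorm_sum_le _ _
    _ = (n : ℝ≥0∞) ^ (r - 1) * ∑ i, avgPow μ B r S (z i • e i) := by
        rw [avgOn_const_mul (Finset.measurable_sum _ fun i _ => measurable_norm_mvec_rpow hB r _),
          avgOn_sum _ fun i => measurable_norm_mvec_rpow hB r _]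
        rfl
    _ ≤ (n : ℝ≥0∞) ^ (r - 1) * ∑ i : Fin n, 2 ^ r * C := by
        gcongr with i
        rw [avgPow_smul hB hr0]
        gcongr
        · exact hz i
        · exact hC i
    _ = _ := by
        rw [Finset.sum_const, Finset.card_univ, Fintype.card_fin, nsmul_eq_mul]
        have h1 := ENNReal.rpow_add_of_nonneg (x := (n : ℝ≥0∞)) (r - 1) 1 (by linarith) zero_le_one
        rw [ENNReal.rpow_one, sub_add_cancel] at h1
        rw [h1]
        ring

end Cells

lemma exists_pos_enorm_rpow_eq {r : ℝ} (hr : 0 < r) {v : ℝ≥0∞} (h0 : v ≠ 0) (h1 : v ≠ ⊤) :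
    ∃ t : ℝ, 0 < t ∧ ‖(t : ℂ)‖ₑ ^ r = v := by
  have ht : v ^ r⁻¹ ≠ ⊤ := ENNReal.rpow_ne_top_of_nonneg (inv_nonneg.2 hr.le) h1
  have h0' : v ^ r⁻¹ ≠ 0 := by simp [h0, h1]
  have hpos := ENNReal.toReal_pos h0' ht
  refine ⟨(v ^ r⁻¹).toReal, hpos, ?_⟩
  rw [← ofReal_norm, Complex.norm_real, Real.norm_of_nonneg hpos.le,
    ENNReal.ofReal_toReal ht, ENNReal.rpow_inv_rpow hr.ne']

lemma mvec_mul {n : ℕ} (A B : Mat n) (v : Vec n) : mvec (A * B) v = mvec A (mvec B v) := by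
  simp only [mvec, Matrix.toLpLin_mul_same, LinearMap.comp_apply]

lemma mvec_one {n : ℕ} (v : Vec n) : mvec (1 : Mat n) v = v := by
  simp [mvec]

lemma enorm_mvec_le_sum {n : ℕ} (A : Mat n) (v : Vec n) :
    ‖mvec A v‖ₑ ≤ (∑ i, ‖mvec A (EuclideanSpace.single i 1)‖ₑ) * ‖v‖ₑ := by
  have hv : v = ∑ i, v i • EuclideanSpace.single i (1 : ℂ) := by
    ext j
    simp [Finset.sum_apply, Pi.single_apply]
  conv_lhs => rw [hv]
  rw [mvec, map_sum, Finset.sum_mul]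
  refine (enorm_sum_le _ _).trans (Finset.sum_le_sum fun i _ => ?_)
  rw [map_smul, enorm_smul, mul_comm, mvec]
  gcongr
  rw [← ofReal_norm, ← ofReal_norm]
  exact ENNReal.ofReal_le_ofReal (PiLp.norm_apply_le v i)

section Cells
variable {X ι : Type*} [MeasurableSpace X] {μ : Measure X} {n : ℕ}

lemma exists_coercive_avgPow {A B : X → Mat n} (hA : ∀ i j, Measurable fun x => A x i j)
    (hAB : ∀ᵐ x ∂μ, A x * B x = 1) {r : ℝ} (hr : 0 < r) {S : Set X} (h0 : μ S ≠ 0)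
    (h1 : μ S ≠ ⊤) : ∃ η : ℝ≥0∞, η ≠ 0 ∧ ∀ e, η * ‖e‖ₑ ^ r ≤ avgPow μ B r S e := by
  set α : X → ℝ≥0∞ := fun y => ∑ i, ‖mvec (A y) (EuclideanSpace.single i 1)‖ₑ with hα
  have hαm : Measurable α := Finset.measurable_sum _ fun i _ =>
    (measurable_mvec hA fun _ => measurable_const).enorm
  have hαt : ∀ y, α y ≠ ⊤ := fun y => by simp [hα]
  set w : X → ℝ≥0∞ := fun y => ((1 + α y) ^ r)⁻¹ with hw
  have hwm : Measurable w := ((measurable_const.add hαm).pow_const r).inv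
  have hw0 : ∀ y, w y ≠ 0 := fun y =>
    ENNReal.inv_ne_zero.2 (ENNReal.rpow_ne_top_of_nonneg hr.le
      (ENNReal.add_ne_top.2 ⟨one_ne_top, hαt y⟩))
  refine ⟨avgOn μ S w, ?_, fun e => ?_⟩
  · refine mul_ne_zero (ENNReal.inv_ne_zero.2 h1) (pos_iff_ne_zero.1 ?_)
    rw [setLIntegral_pos_iff hwm]
    have : Function.support w = Set.univ := Set.eq_univ_of_forall hw0
    rw [this, Set.univ_inter]
    exact pos_iff_ne_zero.2 h0
  · rw [mul_comm, ← avgOn_const_mul hwm]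
    refine mul_le_mul' le_rfl (lintegral_mono_ae ((ae_restrict_of_ae hAB).mono fun y hy => ?_))
    have h2 : ‖e‖ₑ ≤ (1 + α y) * ‖mvec (B y) e‖ₑ := by
      calc ‖e‖ₑ = ‖mvec (A y) (mvec (B y) e)‖ₑ := by rw [← mvec_mul, hy, mvec_one]
        _ ≤ α y * ‖mvec (B y) e‖ₑ := enorm_mvec_le_sum _ _
        _ ≤ _ := by gcongr; exact le_add_self
    rw [mul_comm, ENNReal.inv_mul_le_iff]
    · rw [← ENNReal.mul_rpow_of_nonneg _ _ hr.le]
      gcongr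
    · simp [hr, hr.le]
    · exact ENNReal.inv_ne_zero.1 (hw0 y)

lemma exists_avgPow_basis {B : X → Mat n} (hB : ∀ i j, Measurable fun x => B x i j) {r : ℝ}
    (hr : 1 ≤ r) {Q : Set X} (hfin : ∀ e, avgPow μ B r Q e ≠ ⊤) {η : ℝ≥0∞} (hη : η ≠ 0)
    (hco : ∀ e, η * ‖e‖ₑ ^ r ≤ avgPow μ B r Q e) :
    ∃ e : Fin n → Vec n, (∀ i, avgPow μ B r Q (e i) ≤ 1) ∧
      ∀ (S : Set X) (C : ℝ≥0∞), (∀ i, avgPow μ B r S (e i) ≤ C) →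
        ∀ b, avgPow μ B r S b ≤ 2 ^ r * (n : ℝ≥0∞) ^ r * C * avgPow μ B r Q b := by
  have hr0 : 0 < r := by linarith
  set m : ℝ≥0∞ := 1 + ∑ i : Fin n, avgPow μ B r Q (EuclideanSpace.single i 1) with hm
  have hmt : m ≠ ⊤ := ENNReal.add_ne_top.2 ⟨one_ne_top, by simpa using fun i => hfin _⟩
  have hm0 : m ≠ 0 := by simp [hm]
  obtain ⟨δ, hδ, hδm⟩ := exists_pos_enorm_rpow_eq hr0 (ENNReal.inv_ne_zero.2 hmt)
    (ENNReal.inv_ne_top.2 hm0)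
  have hηi : (η⁻¹) ^ r⁻¹ ≠ ⊤ :=
    ENNReal.rpow_ne_top_of_nonneg (inv_nonneg.2 hr0.le) (ENNReal.inv_ne_top.2 hη)
  have hbdd : ∀ b ∈ {e : Vec n | avgPow μ B r Q e ≤ 1}, ‖b‖ ≤ ((η⁻¹) ^ r⁻¹).toReal := fun b hb => by
    have h1 := (hco b).trans hb
    rw [mul_comm, ← ENNReal.le_inv_iff_mul_le] at h1
    rw [← toReal_enorm]
    refine ENNReal.toReal_mono hηi ?_
    exact (ENNReal.le_rpow_inv_iff hr0).2 h1
  have habs : ∀ i, δ • EuclideanSpace.single i (1 : ℂ) ∈ {e : Vec n | avgPow μ B r Q e ≤ 1} :=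
    fun i => by
    rw [Set.mem_ofPred_eq]
    have h2 := avgPow_smul (μ := μ) hB hr0.le Q (δ : ℂ) (EuclideanSpace.single i 1)
    rw [Complex.coe_smul] at h2
    rw [h2, hδm, ENNReal.inv_mul_le_iff hm0 hmt, mul_one, hm]
    exact (Finset.single_le_sum (f := fun i => avgPow μ B r Q (EuclideanSpace.single i 1))
      (fun _ _ => zero_le) (Finset.mem_univ i)).trans le_add_self
  obtain ⟨e, he, hspan⟩ := exists_basis_coord_le_two hbdd hδ habs
  refine ⟨e, he, fun S C hC b => ?_⟩
  rcases eq_or_ne (avgPow μ B r Q b) 0 with hb0 | hb0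
  · have h1 := hco b
    rw [hb0, nonpos_iff_eq_zero, mul_eq_zero, or_iff_right hη, ENNReal.rpow_eq_zero_iff_of_pos hr0,
      enorm_eq_zero] at h1
    have h2 := avgPow_smul (μ := μ) hB hr0.le S 0 b
    rw [zero_smul, enorm_zero, ENNReal.zero_rpow_of_pos hr0, zero_mul] at h2
    rw [h1, h2]
    exact zero_le
  · obtain ⟨t, ht, htb⟩ := exists_pos_enorm_rpow_eq hr0 (ENNReal.inv_ne_zero.2 (hfin b))
      (ENNReal.inv_ne_top.2 hb0)
    obtain ⟨z, hz, hz2⟩ := hspan ((t : ℂ) • b) (by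
      rw [Set.mem_ofPred_eq, avgPow_smul hB hr0.le, htb, ENNReal.inv_mul_cancel hb0 (hfin b)])
    have h1 := avgPow_sum_le hB hr S e (z := z) (fun i => by
      rw [← ofReal_norm]
      exact (ENNReal.ofReal_le_ofReal (hz2 i)).trans (by simp)) hC
    rw [← hz, avgPow_smul hB hr0.le, htb, ENNReal.inv_mul_le_iff hb0 (hfin b)] at h1
    rwa [mul_comm]

end Cells

section Cells
variable {X ι : Type*} [MeasurableSpace X] {μ : Measure X} {n : ℕ}

/-- The sum over the columns `a` of `A x` of the averages of `‖B a‖ ^ r` over the cell of `x`. -/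
def sumPow (μ : Measure X) (A B : X → Mat n) (r : ℝ) (c : ℕ → X → ι) (k : ℕ) (x : X) : ℝ≥0∞ :=
  ∑ i, avgPow μ B r (cell c k x) (mvec (A x) (EuclideanSpace.single i 1))

variable [MeasurableSpace ι] [Countable ι] [MeasurableSingletonClass ι]

lemma IsNested.measurable_sumPow [SFinite μ] {c : ℕ → X → ι} (hc : IsNested μ c) {A B : X → Mat n}
    (hA : ∀ i j, Measurable fun x => A x i j) (hB : ∀ i j, Measurable fun x => B x i j) (r : ℝ)
    (k : ℕ) : Measurable (sumPow μ A B r c k) := by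
  refine Finset.measurable_sum _ fun i _ => ?_
  have hm : Measurable fun x => (μ (cell c k x))⁻¹ :=
    hc.measurable_of_const (k := k) fun x y h => by rw [cell_congr h]
  refine hm.mul ?_
  set g : X × X → ℝ≥0∞ := {p : X × X | c k p.2 = c k p.1}.indicator fun p =>
    ‖mvec (B p.2) (mvec (A p.1) (EuclideanSpace.single i 1))‖ₑ ^ r with hg
  have hvec : ∀ j, Measurable fun p : X × X => mvec (A p.1) (EuclideanSpace.single i 1) j :=
    fun j => by
    have h : Measurable fun x => mvec (A x) (EuclideanSpace.single i 1) :=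
      measurable_mvec hA fun _ => measurable_const
    have h' : Measurable fun x => WithLp.ofLp (mvec (A x) (EuclideanSpace.single i 1)) :=
      (WithLp.measurable_ofLp 2 _).comp h
    exact (measurable_pi_iff.1 h' j).comp measurable_fst
  have hgm : Measurable g := by
    refine Measurable.indicator ?_ (measurableSet_eq_fun ((hc.meas k).comp measurable_snd)
      ((hc.meas k).comp measurable_fst))
    exact (measurable_mvec (fun i j => (hB i j).comp measurable_snd) hvec).enorm.pow_const r
  convert hgm.lintegral_prod_right' (ν := μ) using 2 with x
  rw [← lintegral_indicator (hc.measurableSet_cell k x)]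
  rfl

lemma IsNested.measure_bad_le {c : ℕ → X → ι} (hc : IsNested μ c) {B : X → Mat n}
    (hB : ∀ i j, Measurable fun x => B x i j) {r : ℝ} (hr : 1 ≤ r) {u : X → ℝ≥0∞}
    (hu : Measurable u) {j : ℕ} {x : X} (hfin : ∀ e, avgPow μ B r (cell c j x) e ≠ ⊤) {η : ℝ≥0∞}
    (hη : η ≠ 0) (hco : ∀ e, η * ‖e‖ₑ ^ r ≤ avgPow μ B r (cell c j x) e) :
    2 * μ {y ∈ cell c j x | ∃ k, j ≤ k ∧
      ¬ (avgOn μ (cell c k y) u ≤ 2 * (n + 1) * avgOn μ (cell c j y) u ∧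
        ∀ e, avgPow μ B r (cell c k y) e ≤
          2 ^ r * (n : ℝ≥0∞) ^ r * (2 * (n + 1)) * avgPow μ B r (cell c j y) e)} ≤
      μ (cell c j x) := by
  obtain ⟨e, he, hspan⟩ := exists_avgPow_basis hB hr hfin hη hco
  set Q := cell c j x with hQ
  set C : ℝ≥0∞ := 2 * (n + 1) with hC
  have hC0 : C ≠ 0 := by simp [hC]
  set E₀ : Set X := {y ∈ Q | ∃ k, j ≤ k ∧ C * avgOn μ Q u < avgOn μ (cell c k y) u} with hE₀
  set E : Fin n → Set X := fun i =>
    {y ∈ Q | ∃ k, j ≤ k ∧ C * 1 < avgPow μ B r (cell c k y) (e i)} with hE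
  have h₀ : C * μ E₀ ≤ μ Q := hc.weak_type_cell hu j x hC0 le_rfl
  have h₁ : ∀ i, C * μ (E i) ≤ μ Q := fun i =>
    hc.weak_type_cell (measurable_norm_mvec_rpow hB r (e i)) j x hC0 (he i)
  have hsub : {y ∈ Q | ∃ k, j ≤ k ∧
      ¬ (avgOn μ (cell c k y) u ≤ C * avgOn μ (cell c j y) u ∧
        ∀ e, avgPow μ B r (cell c k y) e ≤
          2 ^ r * (n : ℝ≥0∞) ^ r * C * avgPow μ B r (cell c j y) e)} ⊆ E₀ ∪ ⋃ i, E i := by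
    rintro y ⟨hy, k, hjk, hbad⟩
    have hcell : cell c j y = Q := cell_congr hy
    rw [hcell] at hbad
    by_contra hcon
    simp only [Set.mem_union, Set.mem_iUnion, not_or, not_exists] at hcon
    refine hbad ⟨?_, fun b => ?_⟩
    · by_contra h
      exact hcon.1 ⟨hy, k, hjk, not_le.1 h⟩
    · refine hspan _ C (fun i => ?_) b
      by_contra h
      exact hcon.2 i ⟨hy, k, hjk, by rw [mul_one]; exact not_le.1 h⟩
  have hn0 : (n : ℝ≥0∞) + 1 ≠ 0 := by simp
  have hnt : (n : ℝ≥0∞) + 1 ≠ ⊤ := by simp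
  rw [← ENNReal.mul_le_mul_iff_right hn0 hnt, ← mul_assoc, mul_comm ((n : ℝ≥0∞) + 1) 2]
  calc C * μ _ ≤ C * (μ E₀ + ∑ i, μ (E i)) := by
        gcongr
        exact (measure_mono hsub).trans ((measure_union_le _ _).trans
          (by gcongr; exact measure_iUnion_fintype_le _ _))
    _ = C * μ E₀ + ∑ i, C * μ (E i) := by rw [mul_add, Finset.mul_sum]
    _ ≤ μ Q + ∑ i : Fin n, μ Q := by gcongr with i; exact h₁ i
    _ = _ := by
      rw [Finset.sum_const, Finset.card_univ, Fintype.card_fin, nsmul_eq_mul]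
      ring

/-- The weighted maximal estimate for a nested sequence of partitions. -/
theorem exists_lintegral_iSup_sumPow_le {n : ℕ} (hn : 1 ≤ n) {a r s : ℝ} (ha : 0 ≤ a) (hr : 1 ≤ r)
    (hs : 1 < s) :
    ∃ C : ℝ≥0∞, C ≠ ⊤ ∧ ∀ {X ι : Type} [MeasurableSpace X] {μ : Measure X} [SFinite μ]
      [MeasurableSpace ι] [Countable ι] [MeasurableSingletonClass ι] {c : ℕ → X → ι},
      IsNested μ c → ∀ {A B : X → Mat n}, (∀ i j, Measurable fun x => A x i j) →
      (∀ i j, Measurable fun x => B x i j) → (∀ᵐ x ∂μ, A x * B x = 1) →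
      (∀ k x e, avgPow μ B r (cell c k x) e ≠ ⊤) → ∀ {K : ℝ≥0∞},
      (∀ k x, ∫⁻ y in cell c k x, sumPow μ A B r c k y ^ a ∂μ ≤ K * μ (cell c k x)) →
      ∀ {u : X → ℝ≥0∞}, Measurable u →
      ∫⁻ x, ⨆ k, sumPow μ A B r c k x ^ a * avgOn μ (cell c k x) u ^ s ∂μ ≤
        C * K * ∫⁻ x, u x ^ s ∂μ := by
  obtain ⟨M, hM, hMle⟩ := exists_lintegral_iSup_avgOn_rpow_le hs
  have hs0 : 0 ≤ s := by linarith
  set C₀ : ℝ≥0∞ := 2 * (n + 1) with hC₀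
  set D' : ℝ≥0∞ := 2 ^ r * (n : ℝ≥0∞) ^ r * C₀ with hD'
  have hC₀t : C₀ ≠ ⊤ := by simp [hC₀, ENNReal.mul_ne_top]
  have hC₀1 : 1 ≤ C₀ := by
    rw [hC₀]
    calc (1 : ℝ≥0∞) = 1 * (0 + 1) := by simp
      _ ≤ _ := by gcongr <;> simp
  have hpow : ∀ m : ℝ≥0∞, m ≠ ⊤ → ∀ t : ℝ, 0 ≤ t → m ^ t ≠ ⊤ := fun m hm t ht =>
    ENNReal.rpow_ne_top_of_nonneg ht hm
  have hD't : D' ≠ ⊤ := ENNReal.mul_ne_top (ENNReal.mul_ne_top (hpow _ (by simp) _ (by linarith))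
    (hpow _ (by simp) _ (by linarith))) hC₀t
  have hD'1 : 1 ≤ D' := by
    have h1 : (1 : ℝ≥0∞) ≤ 2 ^ r := ENNReal.one_le_rpow one_le_two (by linarith)
    have h2 : (1 : ℝ≥0∞) ≤ (n : ℝ≥0∞) ^ r :=
      ENNReal.one_le_rpow (by exact_mod_cast hn) (by linarith)
    calc (1 : ℝ≥0∞) = 1 * 1 * 1 := by simp
      _ ≤ D' := by rw [hD']; gcongr
  refine ⟨2 * (D' ^ a * C₀ ^ s) * M, ?_, ?_⟩
  · exact ENNReal.mul_ne_top (ENNReal.mul_ne_top ofNat_ne_top (ENNReal.mul_ne_top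
      (hpow _ hD't _ ha) (hpow _ hC₀t _ hs0))) hM
  intro X ι _ μ _ _ _ _ c hc A B hA hB hAB hfin K hK u hu
  have key := hc.lintegral_iSup_mul_le (F := fun k x => avgOn μ (cell c k x) u ^ s)
    (a := fun k x => sumPow μ A B r c k x ^ a) (K := K) (D := D' ^ a * C₀ ^ s)
    (bad := fun j k y => ¬ (avgOn μ (cell c k y) u ≤ C₀ * avgOn μ (cell c j y) u ∧
        ∀ e, avgPow μ B r (cell c k y) e ≤ D' * avgPow μ B r (cell c j y) e))
    (fun j k x y hjk h => by rw [cell_congr h, cell_congr (hc.eq_of_le hjk h)])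
    (fun j x h => h ⟨le_mul_of_one_le_left zero_le hC₀1,
      fun e => le_mul_of_one_le_left zero_le hD'1⟩)
    (fun j x => by
      obtain ⟨η, hη, hco⟩ := exists_coercive_avgPow hA hAB (r := r) (by linarith)
        (hc.ne_zero j x) (hc.ne_top j x)
      exact hc.measure_bad_le hB hr hu (hfin j x) hη hco)
    (fun k x y h => by simp only [cell_congr h])
    (fun k => (hc.measurable_sumPow hA hB r k).pow_const a) hK
    (fun j k x _ hgood => by
      obtain ⟨h1, h2⟩ := not_not.1 hgood
      calc sumPow μ A B r c k x ^ a * avgOn μ (cell c k x) u ^ s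
          ≤ (D' * sumPow μ A B r c j x) ^ a * (C₀ * avgOn μ (cell c j x) u) ^ s := by
            gcongr
            rw [sumPow, sumPow, Finset.mul_sum]
            exact Finset.sum_le_sum fun i _ => h2 _
        _ = _ := by
            rw [ENNReal.mul_rpow_of_nonneg _ _ ha, ENNReal.mul_rpow_of_nonneg _ _ hs0]
            ring)
  refine key.trans ?_
  calc _ ≤ 2 * (D' ^ a * C₀ ^ s) * K * ∫⁻ x, (⨆ k, avgOn μ (cell c k x) u) ^ s ∂μ := by
        gcongr with x
        exact iSup_le fun k => ENNReal.rpow_le_rpow (le_iSup (fun k => avgOn μ (cell c k x) u) k) hs0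
    _ ≤ 2 * (D' ^ a * C₀ ^ s) * K * (M * ∫⁻ x, u x ^ s ∂μ) := by gcongr; exact hMle hc hu
    _ = _ := by ring

end Cells

/-- The offset of the `m`-th generation of the standard (`false`) or shifted (`true`) dyadic
intervals. -/
def dyShift (b : Bool) (m : ℤ) : ℝ := if b then (if Even m then 1 / 3 else -1 / 3) else 0

lemma exists_two_mul_dyShift_sub (b : Bool) (m : ℤ) :
    ∃ z : ℤ, 2 * dyShift b m - dyShift b (m + 1) = z := by
  cases b
  · exact ⟨0, by simp [dyShift]⟩
  · by_cases h : Even m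
    · exact ⟨1, by
        simp only [dyShift, if_true, h, Int.even_add_one, not_true_eq_false, if_false]
        norm_num⟩
    · exact ⟨-1, by
        simp only [dyShift, if_true, h, Int.even_add_one, not_false_eq_true, if_false]
        norm_num⟩

lemma floor_sub_div_two_congr {a b : ℝ} (z : ℤ) (h : ⌊a⌋ = ⌊b⌋) : ⌊(a - z) / 2⌋ = ⌊(b - z) / 2⌋ := by
  have key : ∀ {a b : ℝ}, ⌊a⌋ = ⌊b⌋ → ⌊(a - z) / 2⌋ ≤ ⌊(b - z) / 2⌋ := fun {a b} h => by
    rw [Int.le_floor]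
    have h1 : ((2 * ⌊(a - z) / 2⌋ + z : ℤ) : ℝ) ≤ a := by
      have := Int.floor_le ((a - z) / 2)
      push_cast
      linarith
    rw [← Int.le_floor, h, Int.le_floor] at h1
    push_cast at h1
    linarith
  exact le_antisymm (key h) (key h.symm)

lemma exists_floor_sub_dyShift_eq {a b : ℝ} (hab : a ≤ b) (h : b - a < 1 / 3) (m : ℤ) :
    ∃ β, ⌊a - dyShift β m⌋ = ⌊b - dyShift β m⌋ := by
  by_cases h0 : ⌊a⌋ = ⌊b⌋
  · exact ⟨false, by simpa [dyShift] using h0⟩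
  have h1 : ⌊a⌋ + 1 ≤ ⌊b⌋ := lt_of_le_of_ne (Int.floor_mono hab) h0
  have ha := Int.lt_floor_add_one a
  have hb := Int.floor_le b
  have hN : ((⌊a⌋ + 1 : ℤ) : ℝ) ≤ ⌊b⌋ := by exact_mod_cast h1
  push_cast at hN
  refine ⟨true, ?_⟩
  by_cases he : Even m
  · have e1 : ⌊a - 1 / 3⌋ = ⌊a⌋ := by
      rw [Int.floor_eq_iff]; constructor <;> linarith
    have e2 : ⌊b - 1 / 3⌋ = ⌊a⌋ := by
      rw [Int.floor_eq_iff]; constructor <;> linarith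
    simp only [dyShift, he, if_true, e1, e2]
  · have e1 : ⌊a - -1 / 3⌋ = ⌊a⌋ + 1 := by
      rw [Int.floor_eq_iff]; push_cast; constructor <;> linarith
    have e2 : ⌊b - -1 / 3⌋ = ⌊a⌋ + 1 := by
      rw [Int.floor_eq_iff]; push_cast; constructor <;> linarith
    simp only [dyShift, he, if_true, if_false, e1, e2]

/-- The label of the cube of generation `m` containing `x`, in the dyadic grid shifted by `β`. -/
def dyLabel {d : ℕ} (β : Fin d → Bool) (m : ℤ) (x : Rd d) : Fin d → ℤ :=
  fun i => ⌊2 ^ m * x i - dyShift (β i) m⌋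

/-- The cube of generation `m` containing `x`, in the dyadic grid shifted by `β`. -/
def dyCell {d : ℕ} (β : Fin d → Bool) (m : ℤ) (x : Rd d) : Set (Rd d) :=
  dyLabel β m ⁻¹' {dyLabel β m x}

lemma measurable_dyLabel {d : ℕ} (β : Fin d → Bool) (m : ℤ) : Measurable (dyLabel β m) :=
  measurable_pi_lambda _ fun i => Int.measurable_floor.comp
    (((measurable_pi_apply i).comp (WithLp.measurable_ofLp 2 _)).const_mul _ |>.sub_const _)

lemma dyLabel_congr {d : ℕ} {β : Fin d → Bool} {m : ℤ} {x y : Rd d}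
    (h : dyLabel β (m + 1) x = dyLabel β (m + 1) y) : dyLabel β m x = dyLabel β m y := by
  ext i
  obtain ⟨z, hz⟩ := exists_two_mul_dyShift_sub (β i) m
  have e : ∀ x : Rd d, 2 ^ m * x i - dyShift (β i) m =
      (2 ^ (m + 1) * x i - dyShift (β i) (m + 1) - z) / 2 := fun x => by
    rw [← hz, zpow_add_one₀ two_ne_zero]
    ring
  simp only [dyLabel]
  rw [e, e]
  exact floor_sub_div_two_congr z (congrFun h i)

namespace Cube

lemma set_eq_preimage {d : ℕ} (Q : Cube d) : Q.set = WithLp.ofLp ⁻¹'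
    Set.Icc (WithLp.ofLp Q.corner) (WithLp.ofLp Q.corner + fun _ => Q.side) := by
  ext x
  simp only [Cube.set, Set.mem_ofPred_eq, Set.mem_preimage, Set.mem_Icc, Pi.le_def, Pi.add_apply]
  exact forall_and

lemma volume_set {d : ℕ} (Q : Cube d) : volume Q.set = ENNReal.ofReal Q.side ^ d := by
  rw [set_eq_preimage, (PiLp.volume_preserving_ofLp (Fin d)).measure_preimage
    measurableSet_Icc.nullMeasurableSet, Real.volume_Icc_pi]
  simp

lemma volume_set_ne_zero {d : ℕ} (Q : Cube d) : volume Q.set ≠ 0 := by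
  rw [volume_set]
  exact pow_ne_zero _ (ENNReal.ofReal_pos.2 Q.side_pos).ne'

lemma volume_set_ne_top {d : ℕ} (Q : Cube d) : volume Q.set ≠ ⊤ := by
  rw [volume_set]
  exact ENNReal.pow_ne_top ENNReal.ofReal_ne_top

end Cube

/-- The closed cube with the same interior as `dyCell β m x`. -/
def dyCube {d : ℕ} (β : Fin d → Bool) (m : ℤ) (x : Rd d) : Cube d where
  corner := WithLp.toLp 2 fun i => 2 ^ (-m) * (dyLabel β m x i + dyShift (β i) m)
  side := 2 ^ (-m)
  side_pos := by positivity

lemma dyCell_ae_eq {d : ℕ} (β : Fin d → Bool) (m : ℤ) (x : Rd d) :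
    dyCell β m x =ᵐ[volume] (dyCube β m x).set := by
  have e : dyCell β m x = WithLp.ofLp ⁻¹' (Set.univ.pi fun i =>
      Set.Ico ((dyCube β m x).corner i) ((dyCube β m x).corner i + (dyCube β m x).side)) := by
    ext y
    simp only [dyCell, Set.mem_preimage, Set.mem_singleton_iff, Set.mem_pi, Set.mem_univ,
      forall_const, funext_iff]
    refine forall_congr' fun i => ?_
    have h2 : (0 : ℝ) < 2 ^ m := by positivity
    change ⌊_⌋ = _ ↔ _
    rw [Int.floor_eq_iff, Set.mem_Ico]
    simp only [dyCube, zpow_neg]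
    rw [inv_mul_le_iff₀ h2, ← mul_add_one, lt_inv_mul_iff₀ h2]
    constructor <;> rintro ⟨h, h'⟩ <;> constructor <;> linarith
  rw [e, Cube.set_eq_preimage]
  refine (PiLp.volume_preserving_ofLp (Fin d)).quasiMeasurePreserving.preimage_ae_eq ?_
  exact Measure.univ_pi_Ico_ae_eq_Icc

lemma isNested_dyLabel {d : ℕ} (β : Fin d → Bool) (N : ℕ) :
    IsNested volume fun k : ℕ => dyLabel β ((k : ℤ) - N) where
  meas k := measurable_dyLabel β _
  refine k x y h := by
    refine dyLabel_congr ?_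
    push_cast at h
    rwa [add_sub_right_comm] at h
  ne_zero k x := by
    change volume (dyCell β _ x) ≠ 0
    rw [measure_congr (dyCell_ae_eq β _ x)]
    exact Cube.volume_set_ne_zero _
  ne_top k x := by
    change volume (dyCell β _ x) ≠ ⊤
    rw [measure_congr (dyCell_ae_eq β _ x)]
    exact Cube.volume_set_ne_top _

/-- Every cube is contained in a comparable cube of one of the shifted dyadic grids. -/
lemma exists_subset_dyCell {d : ℕ} (Q : Cube d) {x : Rd d} (hx : x ∈ Q.set) :
    ∃ (β : Fin d → Bool) (m : ℤ), Q.set ⊆ dyCell β m x ∧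
      volume (dyCell β m x) ≤ 6 ^ d * volume Q.set := by
  obtain ⟨m, hm, hm'⟩ := exists_mem_Ioc_zpow (x := 1 / (3 * Q.side)) (y := (2 : ℝ))
    (by have := Q.side_pos; positivity) one_lt_two
  have hs := Q.side_pos
  have h2 : (0 : ℝ) < 2 ^ m := by positivity
  have hlt : 2 ^ m * Q.side < 1 / 3 := by
    rw [lt_div_iff₀ (by positivity)] at hm
    linarith
  have hge : (2 : ℝ) ^ (-m) ≤ 6 * Q.side := by
    rw [zpow_add_one₀ two_ne_zero, div_le_iff₀ (by positivity)] at hm'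
    rw [zpow_neg, inv_le_iff_one_le_mul₀ h2]
    linarith
  have hβ := fun i => exists_floor_sub_dyShift_eq (a := 2 ^ m * Q.corner i)
    (b := 2 ^ m * (Q.corner i + Q.side)) (by gcongr; linarith) (by linarith) m
  choose β hβ using hβ
  have hlab : ∀ y ∈ Q.set, ∀ i, dyLabel β m y i = ⌊2 ^ m * Q.corner i - dyShift (β i) m⌋ :=
    fun y hy i => by
    have h := hy i
    refine le_antisymm ?_ ?_
    · rw [hβ i]
      refine Int.floor_mono ?_
      gcongr
      exact h.2
    · refine Int.floor_mono ?_
      gcongr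
      exact h.1
  refine ⟨β, m, fun y hy => ?_, ?_⟩
  · ext i
    rw [hlab y hy, hlab x hx]
  · rw [measure_congr (dyCell_ae_eq β m x), Cube.volume_set, Cube.volume_set, ← mul_pow]
    gcongr
    rw [show (6 : ℝ≥0∞) = ENNReal.ofReal 6 by simp, ← ENNReal.ofReal_mul (by norm_num)]
    exact ENNReal.ofReal_le_ofReal hge

lemma avgOn_set_le {d : ℕ} (Q : Cube d) {x : Rd d} (hx : x ∈ Q.set) (u : Rd d → ℝ≥0∞) :
    ∃ (β : Fin d → Bool) (m : ℤ),
      avgOn volume Q.set u ≤ 6 ^ d * avgOn volume (dyCell β m x) u := by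
  obtain ⟨β, m, hsub, hvol⟩ := exists_subset_dyCell Q hx
  refine ⟨β, m, ?_⟩
  rw [avgOn, avgOn, ← mul_assoc]
  refine mul_le_mul' ?_ (lintegral_mono_set hsub)
  calc (volume Q.set)⁻¹ = 6 ^ d * (6 ^ d * volume Q.set)⁻¹ := by
        rw [ENNReal.mul_inv (by simp) (by simp), ← mul_assoc,
          ENNReal.mul_inv_cancel (by simp) (by simp), one_mul]
    _ ≤ _ := by gcongr

section OpNorm

variable {n : ℕ}

lemma enorm_mvec_le (M : Mat n) (v : Vec n) :
    ‖mvec M v‖ₑ ≤ ENNReal.ofReal (opNorm M) * ‖v‖ₑ := by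
  rw [← ofReal_norm, ← ofReal_norm, ← ENNReal.ofReal_mul (by exact norm_nonneg _)]
  exact ENNReal.ofReal_le_ofReal
    ((Matrix.toEuclideanCLM (𝕜 := ℂ) (n := Fin n) M).le_opNorm v)

lemma ofReal_opNorm_le_sum (M : Mat n) :
    ENNReal.ofReal (opNorm M) ≤ ∑ i, ‖mvec M (EuclideanSpace.single i 1)‖ₑ := by
  have ht : ∑ i, ‖mvec M (EuclideanSpace.single i 1)‖ₑ ≠ ⊤ := by simp
  rw [← ENNReal.ofReal_toReal ht]
  refine ENNReal.ofReal_le_ofReal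
    (ContinuousLinearMap.opNorm_le_bound _ ENNReal.toReal_nonneg fun v => ?_)
  have h := ENNReal.toReal_mono (ENNReal.mul_ne_top ht enorm_ne_top) (enorm_mvec_le_sum M v)
  rw [ENNReal.toReal_mul, toReal_enorm, toReal_enorm] at h
  exact h

open scoped Matrix.Norms.L2Operator in
lemma opNorm_mul_comm {A B : Mat n} (hA : A.IsHermitian) (hB : B.IsHermitian) :
    opNorm (A * B) = opNorm (B * A) := by
  change ‖A * B‖ = ‖B * A‖
  rw [← Matrix.l2_opNorm_conjTranspose, Matrix.conjTranspose_mul, hA.eq, hB.eq]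

lemma enorm_mvec_single_le {A B : Mat n} (hA : A.IsHermitian) (hB : B.IsHermitian) (i : Fin n) :
    ‖mvec B (mvec A (EuclideanSpace.single i 1))‖ₑ ≤ ENNReal.ofReal (opNorm (A * B)) := by
  rw [← mvec_mul, opNorm_mul_comm hA hB]
  refine (enorm_mvec_le _ _).trans_eq ?_
  rw [← ofReal_norm, PiLp.norm_single, norm_one, ENNReal.ofReal_one, mul_one]

lemma ofReal_opNorm_mul_le_sum {A B : Mat n} (hA : A.IsHermitian) (hB : B.IsHermitian) :
    ENNReal.ofReal (opNorm (A * B)) ≤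
      ∑ i, ‖mvec B (mvec A (EuclideanSpace.single i 1))‖ₑ := by
  rw [opNorm_mul_comm hA hB]
  refine (ofReal_opNorm_le_sum _).trans_eq (Finset.sum_congr rfl fun i _ => ?_)
  rw [mvec_mul]

end OpNorm

lemma avgOn_mono_ae {X : Type*} [MeasurableSpace X] {μ : Measure X} {S : Set X} {u v : X → ℝ≥0∞}
    (h : ∀ᵐ x ∂μ, u x ≤ v x) : avgOn μ S u ≤ avgOn μ S v :=
  mul_le_mul' le_rfl (lintegral_mono_ae (ae_restrict_of_ae h))

lemma avgOn_congr_set {X : Type*} [MeasurableSpace X] {μ : Measure X} {S T : Set X}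
    (h : S =ᵐ[μ] T) (u : X → ℝ≥0∞) : avgOn μ S u = avgOn μ T u := by
  rw [avgOn, avgOn, measure_congr h, setLIntegral_congr h]

/-- Hölder's inequality with exponents `p / (q - 1)` and `p / (p - q + 1)`, for averages. -/
lemma avgOn_rpow_mul_rpow_le {X : Type*} [MeasurableSpace X] {μ : Measure X} {S : Set X}
    {p q : ℝ} (hq : 1 < q) (hqp : q < p) {h v : X → ℝ≥0∞} (hh : Measurable h)
    (hv : Measurable v) :
    avgOn μ S (fun y => h y ^ (q / p) * v y) ^ p ≤
      avgOn μ S (fun y => h y ^ (q / (q - 1))) ^ (q - 1) *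
        avgOn μ S (fun y => v y ^ (p / (p - q + 1))) ^ (p - q + 1) := by
  have hp : 0 < p := by linarith
  have hq1 : 0 < q - 1 := by linarith
  have hs : 0 < p - q + 1 := by linarith
  have e : ∀ g : X → ℝ≥0∞, avgOn μ S g = ∫⁻ y, g y ∂((μ S)⁻¹ • μ.restrict S) := fun g => by
    rw [lintegral_smul_measure, avgOn, smul_eq_mul]
  simp only [e]
  have hc : (p / (q - 1)).HolderConjugate (p / (p - q + 1)) := by
    rw [Real.holderConjugate_iff]
    refine ⟨?_, ?_⟩
    · rw [lt_div_iff₀ hq1]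
      linarith
    · field_simp
      ring
  have H := ENNReal.lintegral_mul_le_Lp_mul_Lq ((μ S)⁻¹ • μ.restrict S) hc
    (f := fun y => h y ^ (q / p)) (g := v) (hh.pow_const _).aemeasurable hv.aemeasurable
  refine (ENNReal.rpow_le_rpow H hp.le).trans_eq ?_
  rw [ENNReal.mul_rpow_of_nonneg _ _ hp.le, ← ENNReal.rpow_mul, ← ENNReal.rpow_mul]
  have e1 : 1 / (p / (q - 1)) * p = q - 1 := by field_simp
  have e2 : 1 / (p / (p - q + 1)) * p = p - q + 1 := by field_simp
  have e3 : q / p * (p / (q - 1)) = q / (q - 1) := by field_simp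
  simp only [e1, e2, ← ENNReal.rpow_mul, e3]

section Weight

variable {d n : ℕ} {W : Rd d → Mat n} {B : Rd d → Mat n} {p q : ℝ}

lemma avgOn_enorm_mvec_rpow_le (hq : 1 < q) (hqp : q < p) (hW : ∀ᵐ x, (W x).PosDef)
    (hBm : ∀ i j, Measurable fun x => B x i j) (hB : ∀ᵐ x, B x = matPow (W x) (-(1 / q)))
    {x : Rd d} (hx : (W x).PosDef) {f : Rd d → Vec n} (hf : Measurable fun y => ‖f y‖ₑ)
    (S : Set (Rd d)) :
    avgOn volume S
        (fun y => ‖mvec (matPow (W x) (1 / p) * matPow (W y) (-(1 / p))) (f y)‖ₑ) ^ p ≤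
      ((n : ℝ≥0∞) ^ (q / (q - 1) - 1)) ^ (q - 1) *
        ((∑ i, avgPow volume B (q / (q - 1)) S
            (mvec (matPow (W x) (1 / q)) (EuclideanSpace.single i 1))) ^ (q - 1) *
          avgOn volume S (fun y => ‖f y‖ₑ ^ (p / (p - q + 1))) ^ (p - q + 1)) := by
  have hp : 0 < p := by linarith
  have hq1 : 0 < q - 1 := by linarith
  have hr : 1 ≤ q / (q - 1) := by
    rw [le_div_iff₀ hq1]
    linarith
  set a : Fin n → Vec n := fun i => mvec (matPow (W x) (1 / q)) (EuclideanSpace.single i 1) with ha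
  set h : Rd d → ℝ≥0∞ := fun y => ∑ i, ‖mvec (B y) (a i)‖ₑ with hh
  have hhm : Measurable h := Finset.measurable_sum _ fun i _ =>
    (measurable_mvec hBm fun _ => measurable_const).enorm
  have h1 : avgOn volume S
      (fun y => ‖mvec (matPow (W x) (1 / p) * matPow (W y) (-(1 / p))) (f y)‖ₑ) ≤
      avgOn volume S (fun y => h y ^ (q / p) * ‖f y‖ₑ) := by
    refine avgOn_mono_ae ?_
    filter_upwards [hW, hB] with y hy hBy
    refine (enorm_mvec_le _ _).trans (mul_le_mul' ?_ le_rfl)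
    refine (ENNReal.ofReal_le_ofReal
      (opNorm_matPow_le hx hy (by linarith : 0 < q) hqp.le)).trans ?_
    rw [← ENNReal.ofReal_rpow_of_nonneg (by exact norm_nonneg _) (by positivity)]
    refine ENNReal.rpow_le_rpow ?_ (by positivity)
    simp only [hh, ha, hBy]
    exact ofReal_opNorm_mul_le_sum (isHermitian_matPow hx _) (isHermitian_matPow hy _)
  have h2 : avgOn volume S (fun y => h y ^ (q / (q - 1))) ≤
      (n : ℝ≥0∞) ^ (q / (q - 1) - 1) * ∑ i, avgPow volume B (q / (q - 1)) S (a i) := by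
    have hm : ∀ i, Measurable fun y => ‖mvec (B y) (a i)‖ₑ ^ (q / (q - 1)) := fun i =>
      measurable_norm_mvec_rpow hBm _ _
    calc avgOn volume S (fun y => h y ^ (q / (q - 1)))
        ≤ avgOn volume S (fun y => (n : ℝ≥0∞) ^ (q / (q - 1) - 1) *
            ∑ i, ‖mvec (B y) (a i)‖ₑ ^ (q / (q - 1))) := avgOn_mono fun y => by
          simpa using ENNReal.rpow_sum_le_const_mul_sum_rpow Finset.univ
            (fun i => ‖mvec (B y) (a i)‖ₑ) hr
      _ = _ := by
          rw [avgOn_const_mul (Finset.measurable_sum _ fun i _ => hm i), avgOn_sum _ hm]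
          rfl
  calc _ ≤ avgOn volume S (fun y => h y ^ (q / p) * ‖f y‖ₑ) ^ p := ENNReal.rpow_le_rpow h1 hp.le
    _ ≤ _ := avgOn_rpow_mul_rpow_le hq hqp hhm hf
    _ ≤ _ := mul_le_mul' (ENNReal.rpow_le_rpow h2 hq1.le) le_rfl
    _ = _ := by rw [ENNReal.mul_rpow_of_nonneg _ _ hq1.le, mul_assoc]

lemma sum_avgPow_le (hq : 1 < q) (hW : ∀ᵐ x, (W x).PosDef)
    (hB : ∀ᵐ x, B x = matPow (W x) (-(1 / q))) {x : Rd d} (hx : (W x).PosDef) (S : Set (Rd d)) :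
    ∑ i, avgPow volume B (q / (q - 1)) S
        (mvec (matPow (W x) (1 / q)) (EuclideanSpace.single i 1)) ≤
      n * avgOn volume S fun y => ENNReal.ofReal
        (opNorm (matPow (W x) (1 / q) * matPow (W y) (-(1 / q)))) ^ (q / (q - 1)) := by
  have hr : 0 ≤ q / (q - 1) := div_nonneg (by linarith) (by linarith)
  refine (Finset.sum_le_card_nsmul _ _ _ fun i _ => avgOn_mono_ae ?_).trans_eq
    (by rw [Finset.card_univ, Fintype.card_fin, nsmul_eq_mul])
  filter_upwards [hW, hB] with y hy hBy
  refine ENNReal.rpow_le_rpow ?_ hr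
  rw [hBy]
  exact enorm_mvec_single_le (isHermitian_matPow hx _) (isHermitian_matPow hy _) i

lemma lintegral_avgOn_rpow_le_AqConst (W : Rd d → Mat n) (q : ℝ) (Q : Cube d) :
    ∫⁻ x in Q.set, (avgOn volume Q.set fun y => ENNReal.ofReal
        (opNorm (matPow (W x) (1 / q) * matPow (W y) (-(1 / q)))) ^ (q / (q - 1))) ^ (q - 1) ≤
      AqConst W q * volume Q.set := by
  rw [← ENNReal.div_le_iff Q.volume_set_ne_zero Q.volume_set_ne_top, div_eq_mul_inv, mul_comm]
  exact le_iSup (fun Q : Cube d => (volume Q.set)⁻¹ * ∫⁻ x in Q.set,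
    ((volume Q.set)⁻¹ * ∫⁻ y in Q.set, ENNReal.ofReal
      (opNorm (matPow (W x) (1/q) * matPow (W y) (-(1/q)))) ^ (q/(q-1))) ^ (q-1)) Q

lemma lintegral_sumPow_rpow_le {A : Rd d → Mat n} (hq : 1 < q) (hW : ∀ᵐ x, (W x).PosDef)
    (hA : ∀ᵐ x, A x = matPow (W x) (1 / q)) (hB : ∀ᵐ x, B x = matPow (W x) (-(1 / q)))
    (β : Fin d → Bool) (N k : ℕ) (x : Rd d) :
    ∫⁻ y in cell (fun k : ℕ => dyLabel β ((k : ℤ) - N)) k x,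
        sumPow volume A B (q / (q - 1)) (fun k : ℕ => dyLabel β ((k : ℤ) - N)) k y ^ (q - 1) ≤
      (n : ℝ≥0∞) ^ (q - 1) * AqConst W q *
        volume (cell (fun k : ℕ => dyLabel β ((k : ℤ) - N)) k x) := by
  have hq1 : 0 < q - 1 := by linarith
  set c := fun k : ℕ => dyLabel β ((k : ℤ) - N) with hc
  have hS : cell c k x =ᵐ[volume] (dyCube β ((k : ℤ) - N) x).set := dyCell_ae_eq β _ x
  set Q := dyCube β ((k : ℤ) - N) x
  calc ∫⁻ y in cell c k x, sumPow volume A B (q / (q - 1)) c k y ^ (q - 1)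
      ≤ ∫⁻ y in cell c k x, (n : ℝ≥0∞) ^ (q - 1) *
          (avgOn volume Q.set fun z => ENNReal.ofReal
            (opNorm (matPow (W y) (1 / q) * matPow (W z) (-(1 / q)))) ^ (q / (q - 1))) ^ (q - 1) := by
        refine lintegral_mono_ae ?_
        filter_upwards [ae_restrict_mem ((isNested_dyLabel β N).measurableSet_cell k x),
          ae_restrict_of_ae hW, ae_restrict_of_ae hA] with y hy hWy hAy
        rw [← ENNReal.mul_rpow_of_nonneg _ _ hq1.le]
        refine ENNReal.rpow_le_rpow ?_ hq1.le
        rw [sumPow, cell_congr (mem_cell_iff.1 hy), hAy, ← avgOn_congr_set hS]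
        exact sum_avgPow_le hq hW hB hWy _
    _ = (n : ℝ≥0∞) ^ (q - 1) * ∫⁻ y in Q.set, (avgOn volume Q.set fun z => ENNReal.ofReal
            (opNorm (matPow (W y) (1 / q) * matPow (W z) (-(1 / q)))) ^ (q / (q - 1))) ^ (q - 1) := by
        rw [lintegral_const_mul' _ _ (ENNReal.rpow_ne_top_of_nonneg hq1.le (natCast_ne_top n)),
          setLIntegral_congr hS]
    _ ≤ _ := by
        rw [measure_congr hS, mul_assoc]
        exact mul_le_mul' le_rfl (lintegral_avgOn_rpow_le_AqConst W q Q)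

lemma avgPow_ne_top_of_lintegral_ne_top {X ι : Type*} [MeasurableSpace X] {μ : Measure X} [SFinite μ]
    [MeasurableSpace ι] [Countable ι] [MeasurableSingletonClass ι] {c : ℕ → X → ι}
    (hc : IsNested μ c) {A B : X → Mat n} (hA : ∀ i j, Measurable fun x => A x i j)
    (hB : ∀ i j, Measurable fun x => B x i j) (hAB : ∀ᵐ x ∂μ, A x * B x = 1) {r a : ℝ}
    (hr : 1 ≤ r) (ha : 0 < a) {k : ℕ} {x : X}
    (h : ∫⁻ y in cell c k x, sumPow μ A B r c k y ^ a ∂μ ≠ ⊤) (e : Vec n) :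
    avgPow μ B r (cell c k x) e ≠ ⊤ := by
  have hr0 : 0 ≤ r := by linarith
  have h0 : (ae (μ.restrict (cell c k x))).NeBot := by
    rw [ae_neBot, Ne, Measure.restrict_eq_zero]
    exact hc.ne_zero k x
  obtain ⟨y, hyS, hyt, hyAB⟩ := ((ae_restrict_mem (hc.measurableSet_cell k x)).and
    ((ae_lt_top ((hc.measurable_sumPow hA hB r k).pow_const a) h).and
      (ae_restrict_of_ae hAB))).exists
  rw [ENNReal.rpow_lt_top_iff_of_pos ha, sumPow, cell_congr (mem_cell_iff.1 hyS)] at hyt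
  set z := mvec (B y) e
  set b : Fin n → Vec n := fun i => mvec (A y) (EuclideanSpace.single i 1) with hb
  have he : e = ∑ i, (1 : ℂ) • z i • b i := by
    have hz : z = ∑ i, z i • EuclideanSpace.single i (1 : ℂ) := by
      ext j
      simp [Finset.sum_apply, Pi.single_apply]
    calc e = mvec (A y) z := by rw [← mvec_mul, hyAB, mvec_one]
      _ = mvec (A y) (∑ i, z i • EuclideanSpace.single i (1 : ℂ)) := by rw [← hz]
      _ = _ := by simp only [mvec, map_sum, map_smul, one_smul, hb]
  have hbt : ∀ i, avgPow μ B r (cell c k x) (b i) ≠ ⊤ := fun i =>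
    ((ENNReal.sum_lt_top.1 hyt) i (Finset.mem_univ i)).ne
  rw [he]
  refine ne_top_of_le_ne_top ?_ (avgPow_sum_le hB hr _ (fun i => z i • b i)
    (z := fun _ => 1) (C := ∑ i, ‖z i‖ₑ ^ r * avgPow μ B r (cell c k x) (b i))
    (fun i => by simp) fun i => ?_)
  · refine ENNReal.mul_ne_top (ENNReal.mul_ne_top
      (ENNReal.rpow_ne_top_of_nonneg hr0 ofNat_ne_top)
      (ENNReal.rpow_ne_top_of_nonneg hr0 (natCast_ne_top n))) ?_
    exact ENNReal.sum_ne_top.2 fun i _ => ENNReal.mul_ne_top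
      (ENNReal.rpow_ne_top_of_nonneg hr0 enorm_ne_top) (hbt i)
  · rw [avgPow_smul hB hr0]
    exact Finset.single_le_sum (f := fun i => ‖z i‖ₑ ^ r * avgPow μ B r (cell c k x) (b i))
      (fun _ _ => zero_le) (Finset.mem_univ i)

end Weight

section Weight

variable {d n : ℕ} {W : Rd d → Mat n} {p q : ℝ}

lemma MeasurableV.measurable {f : Rd d → Vec n} (hf : MeasurableV f) : Measurable f :=
  (WithLp.measurable_toLp 2 _).comp (measurable_pi_lambda (fun x => WithLp.ofLp (f x)) hf)

/-- The quantity at `x` and generation `m` of a shifted dyadic grid that controls the average of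
`W(x)^{1/p} W^{-1/p} f` over the dyadic cell of `x`. -/
def dyBound (A B : Rd d → Mat n) (p q : ℝ) (u : Rd d → ℝ≥0∞) (β : Fin d → Bool) (m : ℤ)
    (x : Rd d) : ℝ≥0∞ :=
  (∑ i, avgPow volume B (q / (q - 1)) (dyCell β m x)
    (mvec (A x) (EuclideanSpace.single i 1))) ^ (q - 1) *
      avgOn volume (dyCell β m x) u ^ (p - q + 1)

lemma MWp_rpow_le (hq : 1 < q) (hqp : q < p) (hW : ∀ᵐ x, (W x).PosDef) {A B : Rd d → Mat n}
    (hBm : ∀ i j, Measurable fun x => B x i j) (hB : ∀ᵐ x, B x = matPow (W x) (-(1 / q)))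
    {x : Rd d} (hx : (W x).PosDef) (hAx : A x = matPow (W x) (1 / q)) {f : Rd d → Vec n}
    (hf : MeasurableV f) :
    MWp W p f x ^ p ≤ ((6 : ℝ≥0∞) ^ d) ^ p * ((n : ℝ≥0∞) ^ (q / (q - 1) - 1)) ^ (q - 1) *
      ∑ β, ⨆ N : ℕ, ⨆ k : ℕ,
        dyBound A B p q (fun y => ‖f y‖ₑ ^ (p / (p - q + 1))) β ((k : ℤ) - N) x := by
  have hp : 0 < p := by linarith
  rw [← ENNReal.le_rpow_inv_iff hp]
  refine iSup₂_le fun Q hQ => ?_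
  rw [ENNReal.le_rpow_inv_iff hp]
  obtain ⟨β, m, hm⟩ := avgOn_set_le Q hQ
    fun y => ‖mvec (matPow (W x) (1 / p) * matPow (W y) (-(1 / p))) (f y)‖ₑ
  refine (ENNReal.rpow_le_rpow hm hp.le).trans ?_
  rw [ENNReal.mul_rpow_of_nonneg _ _ hp.le, mul_assoc]
  refine mul_le_mul' le_rfl ((avgOn_enorm_mvec_rpow_le hq hqp hW hBm hB hx
    hf.measurable.enorm _).trans (mul_le_mul' le_rfl ?_))
  rw [← hAx]
  refine le_trans ?_ (Finset.single_le_sum (f := fun β => ⨆ N : ℕ, ⨆ k : ℕ,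
    dyBound A B p q (fun y => ‖f y‖ₑ ^ (p / (p - q + 1))) β ((k : ℤ) - N) x)
    (fun _ _ => zero_le) (Finset.mem_univ β))
  refine le_trans (le_of_eq ?_) (le_iSup₂ (f := fun N k : ℕ =>
    dyBound A B p q (fun y => ‖f y‖ₑ ^ (p / (p - q + 1))) β ((k : ℤ) - N) x)
    (-m).toNat m.toNat)
  rw [Int.toNat_sub_toNat_neg]
  rfl

lemma exists_lintegral_MWp_rpow_le (d : ℕ) {n : ℕ} (hn : 1 ≤ n) {p q : ℝ} (hq : 1 < q)
    (hqp : q < p) :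
    ∃ C : ℝ≥0∞, C ≠ ⊤ ∧ ∀ W : Rd d → Mat n, IsMatrixWeight W → AqConst W q ≠ ⊤ →
      ∀ f : Rd d → Vec n, MeasurableV f →
        ∫⁻ x, MWp W p f x ^ p ≤ C * AqConst W q * ∫⁻ x, ‖f x‖ₑ ^ p := by
  have hp : 0 < p := by linarith
  have hq1 : 0 < q - 1 := by linarith
  have hs : 1 < p - q + 1 := by linarith
  have hs0 : p - q + 1 ≠ 0 := by linarith
  have hr : 1 ≤ q / (q - 1) := by
    rw [le_div_iff₀ hq1]
    linarith
  obtain ⟨C, hC, H⟩ := exists_lintegral_iSup_sumPow_le hn hq1.le hr hs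
  have hnt : ∀ {t : ℝ}, 0 ≤ t → (n : ℝ≥0∞) ^ t ≠ ⊤ := fun ht =>
    ENNReal.rpow_ne_top_of_nonneg ht (natCast_ne_top n)
  set κ : ℝ≥0∞ := ((6 : ℝ≥0∞) ^ d) ^ p * ((n : ℝ≥0∞) ^ (q / (q - 1) - 1)) ^ (q - 1) with hκ
  have hκt : κ ≠ ⊤ := ENNReal.mul_ne_top
    (ENNReal.rpow_ne_top_of_nonneg hp.le (ENNReal.pow_ne_top ofNat_ne_top))
    (ENNReal.rpow_ne_top_of_nonneg hq1.le (hnt (by linarith)))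
  refine ⟨κ * (Fintype.card (Fin d → Bool) * (C * (n : ℝ≥0∞) ^ (q - 1))),
    ENNReal.mul_ne_top hκt (ENNReal.mul_ne_top (natCast_ne_top _)
      (ENNReal.mul_ne_top hC (hnt hq1.le))), fun W hW hWq f hf => ?_⟩
  obtain ⟨A, hAm, hA⟩ := exists_measurable_matPow hW (1 / q)
  obtain ⟨B, hBm, hB⟩ := exists_measurable_matPow hW (-(1 / q))
  have hAB : ∀ᵐ x, A x * B x = 1 := by
    filter_upwards [hW.2, hA, hB] with x hx hAx hBx
    rw [hAx, hBx, matPow_mul_matPow_neg hx]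
  set u : Rd d → ℝ≥0∞ := fun y => ‖f y‖ₑ ^ (p / (p - q + 1)) with hu
  have hum : Measurable u := hf.measurable.enorm.pow_const _
  have hus : ∀ y, u y ^ (p - q + 1) = ‖f y‖ₑ ^ p := fun y => by
    rw [hu, ← ENNReal.rpow_mul, div_mul_cancel₀ _ hs0]
  have hmeas : ∀ (β : Fin d → Bool) (N : ℕ),
      Measurable fun x => ⨆ k : ℕ, dyBound A B p q u β ((k : ℤ) - N) x := fun β N =>
    Measurable.iSup fun k =>
      (((isNested_dyLabel β N).measurable_sumPow hAm hBm _ k).pow_const _).mul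
        (((isNested_dyLabel β N).measurable_avgOn k u).pow_const _)
  have hmono : ∀ β : Fin d → Bool,
      Monotone fun (N : ℕ) x => ⨆ k : ℕ, dyBound A B p q u β ((k : ℤ) - N) x := fun β =>
    monotone_nat_of_le_succ fun N x => iSup_le fun k =>
      le_iSup_of_le (k + 1) (le_of_eq (by push_cast; rw [add_sub_add_right_eq_sub]))
  have hle : ∀ (β : Fin d → Bool) (N : ℕ),
      ∫⁻ x, ⨆ k : ℕ, dyBound A B p q u β ((k : ℤ) - N) x ≤
        C * ((n : ℝ≥0∞) ^ (q - 1) * AqConst W q) * ∫⁻ x, ‖f x‖ₑ ^ p := fun β N => by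
    have hK := lintegral_sumPow_rpow_le hq hW.2 hA hB β N
    simp only [← hus]
    refine H (isNested_dyLabel β N) hAm hBm hAB (fun k x e => ?_) hK hum
    refine avgPow_ne_top_of_lintegral_ne_top (isNested_dyLabel β N) hAm hBm hAB hr hq1
      (ne_top_of_le_ne_top ?_ (hK k x)) e
    exact ENNReal.mul_ne_top (ENNReal.mul_ne_top (hnt hq1.le) hWq)
      ((isNested_dyLabel β N).ne_top k x)
  calc ∫⁻ x, MWp W p f x ^ p
      ≤ ∫⁻ x, κ * ∑ β, ⨆ N : ℕ, ⨆ k : ℕ, dyBound A B p q u β ((k : ℤ) - N) x := by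
        refine lintegral_mono_ae ?_
        filter_upwards [hW.2, hA] with x hx hAx
        exact MWp_rpow_le hq hqp hW.2 hBm hB hx hAx hf
    _ = κ * ∑ β, ⨆ N : ℕ, ∫⁻ x, ⨆ k : ℕ, dyBound A B p q u β ((k : ℤ) - N) x := by
        rw [lintegral_const_mul' _ _ hκt,
          lintegral_finsetSum _ fun β _ => Measurable.iSup fun N => hmeas β N]
        congr 1
        exact Finset.sum_congr rfl fun β _ => lintegral_iSup (hmeas β) (hmono β)
    _ ≤ κ * ∑ _β : Fin d → Bool,
          C * ((n : ℝ≥0∞) ^ (q - 1) * AqConst W q) * ∫⁻ x, ‖f x‖ₑ ^ p := by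
        gcongr with β
        exact iSup_le (hle β)
    _ = _ := by
        rw [Finset.sum_const, Finset.card_univ, nsmul_eq_mul]
        ring

end Weight

/-- `A_q` bound for the weighted maximal operator `M_{W,p}`, `1 < q < p`. -/
theorem aq_bound_MWp (d n : ℕ) (hd : 1 ≤ d) (hn : 1 ≤ n) (p q : ℝ) (hq : 1 < q)
    (hqp : q < p) :
    ∃ c : ℝ≥0∞, 0 < c ∧ c ≠ ⊤ ∧
      ∀ W : Rd d → Mat n, IsMatrixWeight W → AqConst W q ≠ ⊤ →
        ∀ f : Rd d → Vec n, MeasurableV f → lpNormV p f ≠ ⊤ →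
          lpNormE p (MWp W p f) ≤ c * AqConst W q ^ (1/p) * lpNormV p f := by
  obtain ⟨C, hC, H⟩ := exists_lintegral_MWp_rpow_le d hn hq hqp
  have hp : 0 ≤ 1 / p := by
    have : 0 < p := by linarith
    positivity
  refine ⟨C ^ (1 / p) + 1, by simp,
    ENNReal.add_ne_top.2 ⟨ENNReal.rpow_ne_top_of_nonneg hp hC, one_ne_top⟩,
    fun W hW hWq f hf _ => ?_⟩
  calc lpNormE p (MWp W p f) ≤ (C * AqConst W q * ∫⁻ x, ‖f x‖ₑ ^ p) ^ (1 / p) :=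
        ENNReal.rpow_le_rpow (H W hW hWq f hf) hp
    _ = C ^ (1 / p) * AqConst W q ^ (1 / p) * lpNormV p f := by
        rw [ENNReal.mul_rpow_of_nonneg _ _ hp, ENNReal.mul_rpow_of_nonneg _ _ hp]
        rfl
    _ ≤ _ := by
        gcongr
        exact le_self_add

end
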